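/- arXiv:1010.4909 — 3 statements merged into one kernel-verified Lean document; each statement's English description precedes it below -/
import Mathlib

section
/- Let n ≥ 2, let p ∈ (0,1/2], and let F be an odd-linear-dependency-intersecting family of subsets of Z_2^n = (ZMod 2)^n. Then μ_p(F) ≤ p^3, and equality holds if and only if F is a Schur-umvirate, i.e. there exist nonzero vectors x, y with x ≠ y and x + y ≠ 0 such that F consists of all subsets of Z_2^n containing {x, y, x+y}. -/
/-- A family of subsets of `Z_2^n` is odd-linear-dependency-intersecting if the
intersection of any two members contains an odd number of distinct nonzero
vectors summing to zero. -/
def OddLDIntersecting (n : ℕ) (F : Finset (Finset (Fin n → ZMod 2))) : Prop :=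
  ∀ S ∈ F, ∀ T ∈ F, ∃ (l : ℕ) (v : Fin (2 * l + 1) → (Fin n → ZMod 2)),
    Function.Injective v ∧ (∀ i, v i ≠ 0) ∧ (∀ i, v i ∈ S ∩ T) ∧ ∑ i, v i = 0

/-- The `p`-biased measure of a subset `S ⊆ Z_2^n`. -/
noncomputable def muPSet (n : ℕ) (p : ℝ) (S : Finset (Fin n → ZMod 2)) : ℝ :=
  p ^ S.card * (1 - p) ^ (2 ^ n - S.card)

/-- The `p`-biased measure of a family of subsets of `Z_2^n`. -/
noncomputable def muPFam (n : ℕ) (p : ℝ) (F : Finset (Finset (Fin n → ZMod 2))) : ℝ :=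
  ∑ S ∈ F, muPSet n p S

/-- `F` is a Schur-umvirate: the family of all subsets of `Z_2^n` containing a
fixed Schur triple `{x, y, x + y}` of distinct nonzero vectors. -/
def SchurUmvirate (n : ℕ) (F : Finset (Finset (Fin n → ZMod 2))) : Prop :=
  ∃ x y : Fin n → ZMod 2, x ≠ 0 ∧ y ≠ 0 ∧ x ≠ y ∧ x + y ≠ 0 ∧
    F = (Finset.univ : Finset (Fin n → ZMod 2)).powerset.filter
      (fun S => ({x, y, x + y} : Finset (Fin n → ZMod 2)) ⊆ S)

open Finset

section CutStatistics

variable {n : ℕ}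

/-- The members of `G` on which the linear functional `u` does not vanish. -/
def cutPart (u : Fin n → ZMod 2) (G : Finset (Fin n → ZMod 2)) : Finset (Fin n → ZMod 2) :=
  {v ∈ G | u ⬝ᵥ v = 1}

/-- The number of linear functionals `u` that are nonzero on exactly `k` members of `G`. -/
def cutCount (G : Finset (Fin n → ZMod 2)) (k : ℕ) : ℕ :=
  #{u : Fin n → ZMod 2 | #(cutPart u G) = k}

/-- The additive character `v ↦ (-1) ^ (u ⬝ᵥ v)`. -/
def dotSign (u v : Fin n → ZMod 2) : ℤ := if u ⬝ᵥ v = 1 then -1 else 1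

lemma dotSign_add_right (u v w : Fin n → ZMod 2) :
    dotSign u (v + w) = dotSign u v * dotSign u w := by
  have key : ∀ a b : ZMod 2, (if a + b = 1 then (-1 : ℤ) else 1) =
      (if a = 1 then -1 else 1) * (if b = 1 then -1 else 1) := by decide
  simp only [dotSign, dotProduct_add, key]

lemma dotSign_add_left (u u' v : Fin n → ZMod 2) :
    dotSign (u + u') v = dotSign u v * dotSign u' v := by
  simpa only [dotSign, dotProduct_comm _ v] using dotSign_add_right v u u'

lemma dotSign_sum (u : Fin n → ZMod 2) (G : Finset (Fin n → ZMod 2)) :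
    dotSign u (∑ v ∈ G, v) = ∏ v ∈ G, dotSign u v := by
  classical
  induction G using Finset.induction_on with
  | empty => simp [dotSign]
  | insert a s ha ih => rw [sum_insert ha, prod_insert ha, dotSign_add_right, ih]

lemma exists_dotProduct_eq_one {v : Fin n → ZMod 2} (hv : v ≠ 0) :
    ∃ u : Fin n → ZMod 2, u ⬝ᵥ v = 1 := by
  obtain ⟨i, hi⟩ := Function.ne_iff.mp hv
  refine ⟨Pi.single i 1, ?_⟩
  rw [single_dotProduct, one_mul]
  have key : ∀ a : ZMod 2, a ≠ 0 → a = 1 := by decide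
  exact key _ hi

lemma sum_dotSign {v : Fin n → ZMod 2} (hv : v ≠ 0) : ∑ u, dotSign u v = 0 := by
  obtain ⟨w, hw⟩ := exists_dotProduct_eq_one hv
  have h : ∑ u, dotSign u v = ∑ u, dotSign (u + w) v :=
    (Equiv.sum_comp (Equiv.addRight w) fun u => dotSign u v).symm
  have hw' : dotSign w v = -1 := if_pos hw
  simp only [dotSign_add_left, hw', mul_neg, mul_one, sum_neg_distrib] at h
  omega

lemma card_vectors : Fintype.card (Fin n → ZMod 2) = 2 ^ n := by simp

lemma two_mul_card_cutPart (u : Fin n → ZMod 2) (G : Finset (Fin n → ZMod 2)) :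
    2 * (#(cutPart u G) : ℤ) = #G - ∑ v ∈ G, dotSign u v := by
  rw [cutPart, card_filter, card_eq_sum_ones]
  push_cast
  rw [mul_sum, ← sum_sub_distrib]
  refine sum_congr rfl fun v _ => ?_
  unfold dotSign
  split_ifs <;> norm_num

lemma neg_one_pow_card_cutPart (u : Fin n → ZMod 2) (G : Finset (Fin n → ZMod 2)) :
    (-1 : ℤ) ^ #(cutPart u G) = dotSign u (∑ v ∈ G, v) := by
  rw [dotSign_sum, cutPart, ← prod_const, prod_filter]
  rfl

lemma sum_sq_sum_dotSign {G : Finset (Fin n → ZMod 2)} :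
    ∑ u, (∑ v ∈ G, dotSign u v) ^ 2 = (#G : ℤ) * 2 ^ n := by
  simp only [sq, sum_mul_sum, ← dotSign_add_right]
  rw [sum_comm]
  have h : ∀ v ∈ G, ∑ u, ∑ w ∈ G, dotSign u (v + w) = 2 ^ n := by
    intro v hv
    rw [sum_comm, sum_eq_single v]
    · have : v + v = 0 := funext fun i => CharTwo.add_self_eq_zero (v i)
      simp [this, dotSign]
    · intro w _ hwv
      refine sum_dotSign fun h0 => hwv ?_
      exact funext fun i => (CharTwo.add_eq_zero.mp (congrFun h0 i)).symm
    · exact fun h => absurd hv h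
  rw [sum_congr rfl h]
  simp

lemma sum_card_cutPart {G : Finset (Fin n → ZMod 2)} (h0 : 0 ∉ G) :
    2 * ∑ u, (#(cutPart u G) : ℤ) = #G * 2 ^ n := by
  rw [mul_sum]
  simp only [two_mul_card_cutPart, sum_sub_distrib]
  rw [sum_comm (f := fun u v => dotSign u v), sum_eq_zero (s := G)]
  · simp [mul_comm]
  · exact fun v hv => sum_dotSign fun h => h0 (h ▸ hv)

lemma sum_sq_two_mul_card_cutPart_sub {G : Finset (Fin n → ZMod 2)} :
    ∑ u, (2 * (#(cutPart u G) : ℤ) - #G) ^ 2 = (#G : ℤ) * 2 ^ n := by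
  rw [← sum_sq_sum_dotSign]
  refine sum_congr rfl fun u _ => ?_
  rw [two_mul_card_cutPart]
  ring

lemma sum_neg_one_pow_card_cutPart (G : Finset (Fin n → ZMod 2)) :
    ∑ u, (-1 : ℤ) ^ #(cutPart u G) = 0 ∨ ∑ u, (-1 : ℤ) ^ #(cutPart u G) = 2 ^ n := by
  simp only [neg_one_pow_card_cutPart]
  by_cases h : ∑ v ∈ G, v = 0
  · right; simp [h, dotSign]
  · left; exact sum_dotSign h

lemma sum_comp_card_cutPart (G : Finset (Fin n → ZMod 2)) (g : ℕ → ℤ) :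
    ∑ u, g #(cutPart u G) = ∑ k ∈ range (#G + 1), cutCount G k * g k := by
  rw [← sum_fiberwise_of_maps_to (s := univ) (t := range (#G + 1))
    (g := fun u : Fin n → ZMod 2 => #(cutPart u G))]
  · refine sum_congr rfl fun k _ => ?_
    rw [sum_congr rfl (g := fun _ => g k), sum_const, nsmul_eq_mul, cutCount]
    intro u hu
    rw [(mem_filter.mp hu).2]
  · exact fun u _ => mem_range.mpr (Nat.lt_succ_of_le (card_filter_le _ _))

lemma card_cutPart_eq_le (G Q : Finset (Fin n → ZMod 2)) :
    #{u : Fin n → ZMod 2 | cutPart u G = Q} ≤ cutCount G 0 := by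
  rcases ({u : Fin n → ZMod 2 | cutPart u G = Q} : Finset _).eq_empty_or_nonempty with h | ⟨w, hw⟩
  · simp [h]
  refine card_le_card_of_injOn (· + w) ?_ fun a _ b _ h => add_right_cancel h
  intro u hu
  simp only [coe_filter, mem_univ, true_and, Set.mem_ofPred_eq, mem_filter] at hu hw ⊢
  rw [card_eq_zero, cutPart, filter_eq_empty_iff]
  intro v hv hsum
  have huw : u ⬝ᵥ v = 1 ↔ w ⬝ᵥ v = 1 := by
    have := congrArg (v ∈ ·) (hu.trans hw.symm)
    simpa [cutPart, hv] using this
  rw [add_dotProduct] at hsum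
  have key : ∀ a b : ZMod 2, (a = 1 ↔ b = 1) → a + b ≠ 1 := by decide
  exact key _ _ huw hsum

lemma cutCount_card_le (G : Finset (Fin n → ZMod 2)) : cutCount G #G ≤ cutCount G 0 := by
  refine le_trans (card_le_card fun u hu => ?_) (card_cutPart_eq_le G G)
  simp only [mem_filter, mem_univ, true_and] at hu ⊢
  exact eq_of_subset_of_card_le (filter_subset _ _) hu.ge

lemma cutCount_one_le (G : Finset (Fin n → ZMod 2)) : cutCount G 1 ≤ #G * cutCount G 0 := by
  refine le_trans (card_le_card (t := G.biUnion fun v => {u | cutPart u G = {v}}) fun u hu => ?_)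
    (card_biUnion_le_card_mul _ _ _ fun v _ => card_cutPart_eq_le G {v})
  simp only [mem_filter, mem_univ, true_and, mem_biUnion] at hu ⊢
  obtain ⟨v, hv⟩ := card_eq_one.mp hu
  exact ⟨v, filter_subset _ _ (hv ▸ mem_singleton_self v : v ∈ cutPart u G), hv⟩

lemma cutCount_zero_anti {Q G : Finset (Fin n → ZMod 2)} (h : Q ⊆ G) :
    cutCount G 0 ≤ cutCount Q 0 := by
  refine card_le_card fun u hu => ?_
  simp only [mem_filter, mem_univ, true_and, card_eq_zero] at hu ⊢
  exact subset_empty.mp (hu ▸ filter_subset_filter _ h)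

lemma exists_of_cutCount_pos {G : Finset (Fin n → ZMod 2)} {k : ℕ} (h : 0 < cutCount G k) :
    ∃ u, #(cutPart u G) = k := by
  obtain ⟨u, hu⟩ := card_pos.mp h
  exact ⟨u, (mem_filter.mp hu).2⟩

/-- The coefficients of the cut statistics in the spectral certificate. -/
def cutCoeff : ℕ → ℤ
  | 0 => 28
  | 1 => -20
  | 2 => -4
  | 3 => 3
  | _ => 0

lemma abs_cutCoeff_le {m : ℕ} (hm : 9 ≤ m) (k : ℕ) :
    4 * m * |cutCoeff k| ≤ 15 * (2 * (k : ℤ) - m) ^ 2 := by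
  have hm' : (9 : ℤ) ≤ m := by exact_mod_cast hm
  match k with
  | 0 | 1 | 2 | 3 => norm_num [cutCoeff]; nlinarith
  | k + 4 => simp only [cutCoeff, abs_zero, mul_zero]; positivity

lemma abs_sum_cutCoeff_lt {G : Finset (Fin n → ZMod 2)} (hm : 9 ≤ #G) :
    |∑ u, cutCoeff #(cutPart u G)| < 4 * 2 ^ n := by
  have h1 : 4 * #G * |∑ u, cutCoeff #(cutPart u G)| ≤ 15 * (#G * 2 ^ n) := by
    rw [← sum_sq_two_mul_card_cutPart_sub, mul_sum]
    refine le_trans (mul_le_mul_of_nonneg_left (abs_sum_le_sum_abs _ _) (by positivity)) ?_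
    rw [mul_sum]
    exact sum_le_sum fun u _ => abs_cutCoeff_le hm _
  have hm' : (9 : ℤ) ≤ #G := by exact_mod_cast hm
  have h2 : (0 : ℤ) < 2 ^ n := by positivity
  by_contra! h3
  nlinarith [mul_le_mul_of_nonneg_left h3 (by positivity : (0 : ℤ) ≤ 4 * #G), mul_pos (by linarith : (0 : ℤ) < #G) h2]

/-- The eigenvalue attached to `G`. -/
def cutEigenvalue (G : Finset (Fin n → ZMod 2)) : ℤ :=
  (-1) ^ #G * ∑ u, cutCoeff #(cutPart u G)

lemma cutEigenvalue_bound {G : Finset (Fin n → ZMod 2)} (h0 : 0 ∉ G) (hG : G.Nonempty) :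
    -(4 * 2 ^ n) ≤ cutEigenvalue G ∧ (cutEigenvalue G = -(4 * 2 ^ n) →
      #G ≤ 3 ∨ (#G = 4 ∧ 0 < cutCount G 4 ∧ 16 * cutCount G 0 = 2 ^ n) ∨
        (#G = 5 ∧ 0 < cutCount G 4 ∧ 8 * cutCount G 0 = 2 ^ n)) := by
  rcases le_or_gt 9 #G with hm | hm
  · have h := abs_lt.mp (abs_sum_cutCoeff_lt hm)
    unfold cutEigenvalue
    rcases neg_one_pow_eq_or ℤ #G with hs | hs <;> rw [hs] <;>
      exact ⟨by linarith, fun _ => by linarith⟩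
  have hN : (0 : ℤ) < 2 ^ n := by positivity
  have hmass := sum_comp_card_cutPart G fun _ => 1
  have hmean := sum_card_cutPart h0
  have hvar := sum_sq_two_mul_card_cutPart_sub (G := G)
  have hpar := sum_neg_one_pow_card_cutPart G
  have hone : (cutCount G 1 : ℤ) ≤ #G * cutCount G 0 := by exact_mod_cast cutCount_one_le G
  have hlast : (cutCount G #G : ℤ) ≤ cutCount G 0 := by exact_mod_cast cutCount_card_le G
  rw [sum_comp_card_cutPart G fun k => (k : ℤ)] at hmean
  rw [sum_comp_card_cutPart G fun k => (2 * (k : ℤ) - #G) ^ 2] at hvar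
  rw [sum_comp_card_cutPart G fun k => (-1) ^ k] at hpar
  rw [cutEigenvalue, sum_comp_card_cutPart G cutCoeff]
  zify
  have hpos : 1 ≤ #G := hG.card_pos
  have hnn : ∀ k, (0 : ℤ) ≤ cutCount G k := fun k => Nat.cast_nonneg _
  have h_0 := hnn 0
  have h_1 := hnn 1
  have h_2 := hnn 2
  have h_3 := hnn 3
  have h_4 := hnn 4
  have h_5 := hnn 5
  have h_6 := hnn 6
  have h_7 := hnn 7
  have h_8 := hnn 8
  simp only [sum_const, card_univ, card_vectors, nsmul_eq_mul] at hmass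
  generalize (#G) = m at *
  generalize cutCount G = N at *
  interval_cases m <;>
    norm_num [sum_range_succ, cutCoeff] at hmass hmean hvar hpar hone hlast ⊢
  · linarith
  · linarith
  · linarith
  · rcases hpar with hpar | hpar
    · exact ⟨by linarith, fun h => ⟨by linarith, by linarith⟩⟩
    · exact ⟨by linarith, fun h => ⟨by linarith, by linarith⟩⟩
  · rcases hpar with hpar | hpar
    · exact ⟨by linarith, fun h => ⟨by linarith, by linarith⟩⟩
    · exact ⟨by linarith, fun h => ⟨by linarith, by linarith⟩⟩
  · exact ⟨by linarith, fun h => by linarith⟩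
  · exact ⟨by linarith, fun h => by linarith⟩
  · exact ⟨by linarith, fun h => by linarith⟩

end CutStatistics

section Fourier

variable {α : Type*} [DecidableEq α]

/-- The sign `-1` on `S` and `1` off `S`. -/
def memSign (S : Finset α) (i : α) : ℤ := if i ∈ S then -1 else 1

/-- The unnormalised Fourier coefficient of the indicator function of `F` at `G`. -/
def signCoeff (F : Finset (Finset α)) (G : Finset α) : ℤ :=
  ∑ S ∈ F, ∏ i ∈ G, memSign S i

lemma signCoeff_empty (F : Finset (Finset α)) : signCoeff F ∅ = #F := by
  simp [signCoeff]

lemma signCoeff_sq (F : Finset (Finset α)) (G : Finset α) :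
    signCoeff F G ^ 2 = ∑ S ∈ F, ∑ T ∈ F, ∏ i ∈ G, memSign S i * memSign T i := by
  simp only [signCoeff, sq, sum_mul_sum, prod_mul_distrib]

variable [Fintype α]

lemma sum_prod_memSign_mul (S T : Finset α) :
    ∑ G : Finset α, ∏ i ∈ G, memSign S i * memSign T i =
      if S = T then 2 ^ Fintype.card α else 0 := by
  rw [← powerset_univ, ← prod_one_add]
  split_ifs with h
  · subst h
    rw [prod_congr rfl (g := fun _ => (2 : ℤ)), prod_const, card_univ]
    intro i _
    unfold memSign
    split_ifs <;> norm_num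
  · obtain ⟨i, hi⟩ : ∃ i, ¬(i ∈ S ↔ i ∈ T) := by
      by_contra! hST
      exact h (ext hST)
    refine prod_eq_zero (mem_univ i) ?_
    unfold memSign
    split_ifs <;> simp_all

lemma sum_signCoeff_sq (F : Finset (Finset α)) :
    ∑ G, signCoeff F G ^ 2 = 2 ^ Fintype.card α * #F := by
  simp only [signCoeff_sq]
  rw [sum_comm]
  have h : ∀ S ∈ F, ∑ G : Finset α, ∑ T ∈ F, ∏ i ∈ G, memSign S i * memSign T i =
      2 ^ Fintype.card α := by
    intro S hS
    rw [sum_comm]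
    simp [sum_prod_memSign_mul, hS]
  rw [sum_congr rfl h]
  simp [mul_comm]

lemma fourier_inversion (F : Finset (Finset α)) (T : Finset α) :
    ∑ G, signCoeff F G * ∏ i ∈ G, memSign T i = if T ∈ F then 2 ^ Fintype.card α else 0 := by
  simp only [signCoeff, sum_mul, ← prod_mul_distrib]
  rw [sum_comm]
  simp [sum_prod_memSign_mul]

/-- If no two members of `F` intersect within `B`, the signed Fourier weight of the sets with
prescribed trace on `B` vanishes. -/
lemma sum_neg_one_pow_mul_signCoeff_sq {F : Finset (Finset α)} {B : Finset α}
    (hF : ∀ S ∈ F, ∀ T ∈ F, ¬S ∩ T ⊆ B) {Q : Finset α} (hQ : Q ⊆ B) :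
    ∑ G with G ∩ B = Q, (-1) ^ #G * signCoeff F G ^ 2 = 0 := by
  simp only [signCoeff_sq, mul_sum]
  rw [sum_comm]
  refine sum_eq_zero fun S hS => ?_
  rw [sum_comm]
  refine sum_eq_zero fun T hT => ?_
  obtain ⟨i, hi, hiB⟩ := not_subset.mp (hF S hS T hT)
  rw [mem_inter] at hi
  have hprod : ∏ j ∈ Bᶜ, (1 + -(memSign S j * memSign T j)) = 0 :=
    prod_eq_zero (mem_compl.mpr hiB) (by simp [memSign, hi.1, hi.2])
  rw [prod_one_add] at hprod
  have hdisj : ∀ H ∈ Bᶜ.powerset, Disjoint Q H := fun H hH =>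
    disjoint_of_subset_left hQ (disjoint_of_subset_right (mem_powerset.mp hH) disjoint_compl_right)
  have hterm : ∀ G : Finset α, (-1) ^ #G * ∏ j ∈ G, memSign S j * memSign T j =
      ∏ j ∈ G, -(memSign S j * memSign T j) := fun G => (prod_neg _).symm
  simp only [hterm]
  calc _ = ∑ H ∈ Bᶜ.powerset, ∏ j ∈ Q ∪ H, -(memSign S j * memSign T j) := by
        refine sum_nbij' (fun G => G \ B) (fun H => Q ∪ H) ?_ ?_ ?_ ?_ ?_
        · intro G _
          rw [mem_powerset, sdiff_eq_inter_compl]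
          exact inter_subset_right
        · intro H hH
          have hHB : H ∩ B = ∅ := by
            rw [← disjoint_iff_inter_eq_empty]
            exact disjoint_of_subset_left (mem_powerset.mp hH) disjoint_compl_left
          simp [union_inter_distrib_right, hHB, inter_eq_left.mpr hQ]
        · intro G hG
          rw [← (mem_filter.mp hG).2, union_comm, sdiff_union_inter]
        · intro H hH
          have hHB : Disjoint H B :=
            disjoint_of_subset_left (mem_powerset.mp hH) disjoint_compl_left
          rw [union_sdiff_distrib, sdiff_eq_empty_iff_subset.mpr hQ, empty_union,
            sdiff_eq_self_of_disjoint hHB]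
        · intro G hG
          rw [← (mem_filter.mp hG).2, union_comm, sdiff_union_inter]
    _ = 0 := by
        rw [sum_congr rfl fun H hH => prod_union (hdisj H hH), ← mul_sum, hprod, mul_zero]

lemma sum_neg_one_pow_mul_comp_inter_mul_signCoeff_sq {F : Finset (Finset α)} {B : Finset α}
    (hF : ∀ S ∈ F, ∀ T ∈ F, ¬S ∩ T ⊆ B) (h : Finset α → ℤ) :
    ∑ G, (-1) ^ #G * h (G ∩ B) * signCoeff F G ^ 2 = 0 := by
  rw [← sum_fiberwise_of_maps_to (s := univ) (t := B.powerset) (g := fun G => G ∩ B)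
    fun G _ => mem_powerset.mpr inter_subset_right]
  refine sum_eq_zero fun Q hQ => ?_
  rw [← mul_zero (h Q), ← sum_neg_one_pow_mul_signCoeff_sq hF (mem_powerset.mp hQ), mul_sum]
  refine sum_congr rfl fun G hG => ?_
  rw [(mem_filter.mp hG).2]
  ring

/-- An inclusion-minimal member of `F` is contained in some set of the Fourier support of `F`. -/
lemma exists_signCoeff_ne_zero_of_minimal {F : Finset (Finset α)} {K : Finset α} (hK : K ∈ F)
    (hmin : ∀ T ∈ F, T ⊆ K → T = K) : ∃ G, signCoeff F G ≠ 0 ∧ K ⊆ G := by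
  by_contra! hG
  have hsum : ∑ T ∈ K.powerset, (-1) ^ #T * ∑ G, signCoeff F G * ∏ i ∈ G, memSign T i = 0 := by
    simp only [mul_sum]
    rw [sum_comm]
    refine sum_eq_zero fun G _ => ?_
    by_cases h : signCoeff F G = 0
    · simp [h]
    obtain ⟨i, hiK, hiG⟩ := not_subset.mp (hG G h)
    have hterm : ∀ T ∈ K.powerset, (-1) ^ #T * (signCoeff F G * ∏ j ∈ G, memSign T j) =
        signCoeff F G * ∏ j ∈ T, -memSign G j := by
      intro T _
      have hcomm : ∏ j ∈ G, memSign T j = ∏ j ∈ T, memSign G j := by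
        simp only [memSign, prod_ite_mem]
        rw [inter_comm]
      rw [prod_neg, hcomm]
      ring
    rw [sum_congr rfl hterm, ← mul_sum, ← prod_one_add,
      prod_eq_zero hiK (by simp [memSign, hiG]), mul_zero]
  simp only [fourier_inversion] at hsum
  rw [sum_eq_single K] at hsum
  · simp [hK] at hsum
  · intro T hT hTK
    rw [if_neg fun h => hTK (hmin T h (mem_powerset.mp hT)), mul_zero]
  · simp

end Fourier

section Biased

variable {α : Type*} [DecidableEq α]

/-- The `p`-biased expectation of `f` over the subsets of `U`. -/
noncomputable def biasedMean (p : ℝ) (U : Finset α) (f : Finset α → ℝ) : ℝ :=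
  ∑ S ∈ U.powerset, p ^ #S * (1 - p) ^ (#U - #S) * f S

lemma biasedMean_insert (p : ℝ) {U : Finset α} {a : α} (ha : a ∉ U) (f : Finset α → ℝ) :
    biasedMean p (insert a U) f =
      (1 - p) * biasedMean p U f + p * biasedMean p U fun S => f (insert a S) := by
  unfold biasedMean
  rw [sum_powerset_insert ha, mul_sum, mul_sum]
  congr 1 <;> refine sum_congr rfl fun S hS => ?_
  · have hle := card_le_card (mem_powerset.mp hS)
    rw [card_insert_of_notMem ha, Nat.sub_add_comm hle, pow_succ (1 - p)]
    ring
  · have haS : a ∉ S := fun h => ha (mem_powerset.mp hS h)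
    rw [card_insert_of_notMem ha, card_insert_of_notMem haS, Nat.add_sub_add_right]
    ring

omit [DecidableEq α] in
lemma biasedMean_nonneg {p : ℝ} (hp0 : 0 ≤ p) (hp1 : p ≤ 1) (U : Finset α) {f : Finset α → ℝ}
    (hf : ∀ S, 0 ≤ f S) : 0 ≤ biasedMean p U f := by
  have := sub_nonneg.mpr hp1
  exact sum_nonneg fun S _ => mul_nonneg (by positivity) (hf S)

omit [DecidableEq α] in
lemma biasedMean_mono {p : ℝ} (hp0 : 0 ≤ p) (hp1 : p ≤ 1) (U : Finset α) {f g : Finset α → ℝ}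
    (hfg : ∀ S, f S ≤ g S) : biasedMean p U f ≤ biasedMean p U g := by
  have := sub_nonneg.mpr hp1
  exact sum_le_sum fun S _ => mul_le_mul_of_nonneg_left (hfg S) (by positivity)

lemma two_point_rpow_le {a b t γ : ℝ} (ha : 0 ≤ a) (hab : a ≤ b) (ht0 : 0 ≤ t) (ht1 : t ≤ 1)
    (hγ : 1 ≤ γ) :
    (1 - t ^ γ) * a ^ γ + t ^ γ * b ^ γ ≤ ((1 - t) * a + t * b) ^ γ := by
  have hb := ha.trans hab
  have h1t := sub_nonneg.mpr ht1
  rw [sub_mul, one_mul, ← Real.mul_rpow ht0 ha, ← Real.mul_rpow ht0 hb]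
  set w := (1 - t) * a + t * b with hw
  have hta : 0 ≤ t * a := mul_nonneg ht0 ha
  have htaw : t * a ≤ a := by nlinarith
  have haw : a ≤ w := by nlinarith
  rcases (htaw.trans haw).eq_or_lt with heq | hlt
  · have h1 : a = t * a := le_antisymm (by linarith) htaw
    have h2 : t * b = w := by linarith
    rw [h2, ← h1]
    linarith
  · have hd : 0 < w - t * a := sub_pos.mpr hlt
    set s := (a - t * a) / (w - t * a) with hs
    have hs0 : 0 ≤ s := div_nonneg (by linarith) hd.le
    have hs1 : s ≤ 1 := (div_le_one hd).mpr (by linarith)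
    have hsd : s * (w - t * a) = a - t * a := div_mul_cancel₀ _ hd.ne'
    have hconv := (convexOn_rpow hγ).2
    have h1 := hconv (x := t * a) hta (y := w) (Set.mem_Ici.mpr (by linarith))
      (sub_nonneg.mpr hs1) hs0 (by ring)
    have h2 := hconv (x := t * a) hta (y := w) (Set.mem_Ici.mpr (by linarith))
      hs0 (sub_nonneg.mpr hs1) (by ring)
    simp only [smul_eq_mul] at h1 h2
    rw [show (1 - s) * (t * a) + s * w = a by linarith] at h1
    rw [show s * (t * a) + (1 - s) * w = t * b by linarith] at h2
    linarith

/-- For monotone `f ≥ 0` and `γ ≥ 1`, the `p ^ γ`-biased mean of `f ^ γ` is at most the `γ`-th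
power of the `p`-biased mean of `f`. -/
lemma biasedMean_rpow_le {p γ : ℝ} (hp0 : 0 ≤ p) (hp1 : p ≤ 1) (hγ : 1 ≤ γ) (U : Finset α)
    {f : Finset α → ℝ} (hf : ∀ S, 0 ≤ f S) (hmono : Monotone f) :
    biasedMean (p ^ γ) U (fun S => f S ^ γ) ≤ biasedMean p U f ^ γ := by
  induction U using Finset.induction_on generalizing f with
  | empty => simp [biasedMean]
  | insert a U ha ih =>
    rw [biasedMean_insert _ ha, biasedMean_insert _ ha]
    have hp0' : 0 ≤ p ^ γ := Real.rpow_nonneg hp0 γ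
    have hp1' : p ^ γ ≤ 1 := Real.rpow_le_one hp0 hp1 (by linarith)
    have hg : Monotone fun S => f (insert a S) := fun S T h => hmono (insert_subset_insert a h)
    refine le_trans (add_le_add
      (mul_le_mul_of_nonneg_left (ih hf hmono) (sub_nonneg.mpr hp1'))
      (mul_le_mul_of_nonneg_left (ih (fun S => hf _) hg) hp0')) ?_
    exact two_point_rpow_le (biasedMean_nonneg hp0 hp1 U hf)
      (biasedMean_mono hp0 hp1 U fun S => hmono (subset_insert a S)) hp0 hp1 hγ

lemma sum_superset_biased [Fintype α] (p : ℝ) (K : Finset α) :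
    ∑ S with K ⊆ S, p ^ #S * (1 - p) ^ (Fintype.card α - #S) = p ^ #K := by
  have h : ∑ S with K ⊆ S, p ^ #S * (1 - p) ^ (Fintype.card α - #S) =
      ∑ R ∈ Kᶜ.powerset, p ^ #K * (p ^ #R * (1 - p) ^ (#Kᶜ - #R)) := by
    refine sum_nbij' (fun S => S \ K) (fun R => K ∪ R) ?_ ?_ ?_ ?_ ?_
    · intro S _
      rw [mem_powerset, sdiff_eq_inter_compl]
      exact inter_subset_right
    · intro R _
      simp
    · intro S hS
      exact union_sdiff_of_subset (mem_filter.mp hS).2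
    · intro R hR
      rw [union_sdiff_cancel_left]
      exact disjoint_of_subset_right (mem_powerset.mp hR) disjoint_compl_right
    · intro S hS
      have hKS := (mem_filter.mp hS).2
      have h1 := card_sdiff_add_card_eq_card hKS
      rw [card_compl, ← h1, pow_add, show Fintype.card α - (#(S \ K) + #K) =
        Fintype.card α - #K - #(S \ K) by omega]
      ring
  rw [h, ← mul_sum, sum_pow_mul_eq_add_pow]
  simp

lemma card_superset [Fintype α] (K : Finset α) :
    #({S | K ⊆ S} : Finset (Finset α)) = 2 ^ (Fintype.card α - #K) := by
  have h : ({S | K ⊆ S} : Finset (Finset α)) = Icc K univ := by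
    ext S
    simp
  rw [h, card_Icc_finset (subset_univ K), card_univ]

end Biased

section UniformMeasure

variable {n : ℕ} {F : Finset (Finset (Fin n → ZMod 2))}

lemma OddLDIntersecting.not_inter_subset (hF : OddLDIntersecting n F) (u : Fin n → ZMod 2) :
    ∀ S ∈ F, ∀ T ∈ F, ¬S ∩ T ⊆ insert 0 ({v | u ⬝ᵥ v = 1} : Finset (Fin n → ZMod 2)) := by
  intro S hS T hT hST
  obtain ⟨l, v, -, hv0, hvST, hsum⟩ := hF S hS T hT
  have hv : ∀ i, u ⬝ᵥ v i = 1 := fun i => by simpa [hv0 i] using hST (hvST i)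
  have h : u ⬝ᵥ ∑ i, v i = 1 := by
    rw [dotProduct_sum, sum_congr rfl fun i _ => hv i]
    simp [show (2 : ZMod 2) = 0 from rfl]
  rw [hsum, dotProduct_zero] at h
  exact zero_ne_one h

lemma inter_insert_zero_eq_cutPart {G : Finset (Fin n → ZMod 2)} (h0 : 0 ∉ G)
    (u : Fin n → ZMod 2) :
    G ∩ insert 0 ({v | u ⬝ᵥ v = 1} : Finset (Fin n → ZMod 2)) = cutPart u G := by
  rw [inter_insert_of_notMem h0, cutPart, inter_filter, inter_univ]

lemma sum_cutEigenvalue_mul_signCoeff_sq (hF : OddLDIntersecting n F) :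
    ∑ G, (if 0 ∈ G then 0 else cutEigenvalue G) * signCoeff F G ^ 2 = 0 := by
  have h : ∀ u : Fin n → ZMod 2, _ := fun u =>
    sum_neg_one_pow_mul_comp_inter_mul_signCoeff_sq (hF.not_inter_subset u)
      fun Q => if 0 ∈ Q then 0 else cutCoeff #Q
  have hz := sum_eq_zero fun u (_ : u ∈ univ) => h u
  rw [sum_comm] at hz
  refine Eq.trans ?_ hz
  refine sum_congr rfl fun G _ => ?_
  rw [← sum_mul, ← mul_sum]
  split_ifs with h0
  · simp [h0]
  · rw [cutEigenvalue]
    congr 2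
    refine sum_congr rfl fun u _ => ?_
    have hu : 0 ∉ cutPart u G := fun h => h0 (mem_filter.mp h).1
    rw [inter_insert_zero_eq_cutPart h0, if_neg hu]

lemma cutEigenvalue_empty : cutEigenvalue (∅ : Finset (Fin n → ZMod 2)) = 28 * 2 ^ n := by
  simp [cutEigenvalue, cutPart, cutCoeff, mul_comm]

lemma sum_shifted_cutEigenvalue (hF : OddLDIntersecting n F) :
    32 * 2 ^ n * (#F : ℤ) ^ 2 + ∑ G ∈ univ.erase ∅,
      ((if 0 ∈ G then 0 else cutEigenvalue G) + 4 * 2 ^ n) * signCoeff F G ^ 2 =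
      4 * 2 ^ n * (2 ^ 2 ^ n * #F) := by
  have hpars := sum_signCoeff_sq F
  rw [card_vectors] at hpars
  have hshift : ∑ G, ((if 0 ∈ G then 0 else cutEigenvalue G) + 4 * 2 ^ n) * signCoeff F G ^ 2 =
      4 * 2 ^ n * (2 ^ 2 ^ n * (#F : ℤ)) := by
    simp only [add_mul, sum_add_distrib]
    rw [sum_cutEigenvalue_mul_signCoeff_sq hF, zero_add, ← mul_sum, hpars]
  rw [← hshift, ← add_sum_erase _ _ (mem_univ ∅)]
  simp only [signCoeff_empty, cutEigenvalue_empty, notMem_empty, if_false]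
  ring

lemma shifted_cutEigenvalue_nonneg {G : Finset (Fin n → ZMod 2)} (hG : G ≠ ∅) :
    0 ≤ (if 0 ∈ G then 0 else cutEigenvalue G) + 4 * 2 ^ n := by
  split_ifs with h0
  · positivity
  · linarith [(cutEigenvalue_bound h0 (nonempty_iff_ne_empty.mpr hG)).1]

lemma OddLDIntersecting.eight_mul_card_le (hF : OddLDIntersecting n F) : 8 * #F ≤ 2 ^ 2 ^ n := by
  rcases F.eq_empty_or_nonempty with rfl | hne
  · simp
  have h := sum_shifted_cutEigenvalue hF
  have hnn : 0 ≤ ∑ G ∈ univ.erase ∅,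
      ((if 0 ∈ G then 0 else cutEigenvalue G) + 4 * 2 ^ n) * signCoeff F G ^ 2 :=
    sum_nonneg fun G hG =>
      mul_nonneg (shifted_cutEigenvalue_nonneg (ne_of_mem_erase hG)) (sq_nonneg _)
  have hcard : (0 : ℤ) < #F := by exact_mod_cast hne.card_pos
  have hpos : (0 : ℤ) < 4 * 2 ^ n * #F := by positivity
  zify
  refine le_of_mul_le_mul_left ?_ hpos
  linarith

/-- In the extremal case the spectrum lives on the empty set and the least eigenvalue. -/
lemma cutEigenvalue_eq_of_signCoeff_ne_zero (hF : OddLDIntersecting n F)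
    (hcard : 8 * #F = 2 ^ 2 ^ n) {G : Finset (Fin n → ZMod 2)} (hG : signCoeff F G ≠ 0)
    (hne : G ≠ ∅) : 0 ∉ G ∧ cutEigenvalue G = -(4 * 2 ^ n) := by
  have h := sum_shifted_cutEigenvalue hF
  have hcard' : (2 : ℤ) ^ 2 ^ n = 8 * #F := by exact_mod_cast hcard.symm
  have hsum : ∑ G ∈ univ.erase ∅,
      ((if 0 ∈ G then 0 else cutEigenvalue G) + 4 * 2 ^ n) * signCoeff F G ^ 2 = 0 := by
    rw [hcard'] at h
    linarith
  rw [sum_eq_zero_iff_of_nonneg fun G hG =>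
    mul_nonneg (shifted_cutEigenvalue_nonneg (ne_of_mem_erase hG)) (sq_nonneg _)] at hsum
  have hzero := (mul_eq_zero.mp (hsum G (mem_erase.mpr ⟨hne, mem_univ G⟩))).resolve_right
    (pow_ne_zero 2 hG)
  have hN : (0 : ℤ) < 2 ^ n := by positivity
  split_ifs at hzero with h0
  · linarith
  · exact ⟨h0, by linarith⟩

lemma extremal_support_cases (hF : OddLDIntersecting n F) (hcard : 8 * #F = 2 ^ 2 ^ n)
    {G : Finset (Fin n → ZMod 2)} (hG : signCoeff F G ≠ 0) (h3 : 3 < #G) :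
    0 ∉ G ∧ ((#G = 4 ∧ 0 < cutCount G 4 ∧ 16 * cutCount G 0 = 2 ^ n) ∨
        (#G = 5 ∧ 0 < cutCount G 4 ∧ 8 * cutCount G 0 = 2 ^ n)) := by
  have hne : G.Nonempty := card_pos.mp (by omega)
  obtain ⟨h0, hev⟩ := cutEigenvalue_eq_of_signCoeff_ne_zero hF hcard hG hne.ne_empty
  exact ⟨h0, ((cutEigenvalue_bound h0 hne).2 hev).resolve_left (by omega)⟩

lemma signCoeff_eq_zero_of_card_eq_four (hF : OddLDIntersecting n F) (hcard : 8 * #F = 2 ^ 2 ^ n)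
    {Q : Finset (Fin n → ZMod 2)} (hQ : #Q = 4) : signCoeff F Q = 0 := by
  by_contra hne
  obtain ⟨h0, h⟩ := extremal_support_cases hF hcard hne (by omega)
  obtain ⟨-, hpos, hN⟩ := h.resolve_right (by omega)
  obtain ⟨u, hu⟩ := exists_of_cutCount_pos hpos
  have hQu : cutPart u Q = Q := eq_of_subset_of_card_le (filter_subset _ _) (by omega)
  have hQB := inter_insert_zero_eq_cutPart h0 u
  rw [hQu] at hQB
  have hsum := sum_neg_one_pow_mul_signCoeff_sq (hF.not_inter_subset u) (inter_eq_left.mp hQB)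
  rw [sum_eq_single_of_mem Q (by simp [hQB])] at hsum
  · simp [hQ, hne] at hsum
  · intro G hG hGQ
    by_contra hGne
    have hGne' : signCoeff F G ≠ 0 := fun h => hGne (by simp [h])
    have hQG : Q ⊂ G := by
      refine ssubset_of_subset_of_ne ?_ (Ne.symm hGQ)
      rw [← (mem_filter.mp hG).2]
      exact inter_subset_left
    have hlt := card_lt_card hQG
    have hcase := (extremal_support_cases hF hcard hGne' (by omega)).2
    have hmono := cutCount_zero_anti hQG.subset
    have hNpos : 0 < 2 ^ n := by positivity
    omega

lemma card_le_three_of_signCoeff_ne_zero (hF : OddLDIntersecting n F)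
    (hcard : 8 * #F = 2 ^ 2 ^ n) {G : Finset (Fin n → ZMod 2)} (hG : signCoeff F G ≠ 0) :
    #G ≤ 3 := by
  by_contra! h3
  have h4 : ∀ {H : Finset (Fin n → ZMod 2)}, signCoeff F H ≠ 0 → 3 < #H → #H = 5 := by
    intro H hH hH3
    have h5 := (extremal_support_cases hF hcard hH hH3).2
    have : #H ≠ 4 := fun h => hH (signCoeff_eq_zero_of_card_eq_four hF hcard h)
    tauto
  obtain ⟨h0, h⟩ := extremal_support_cases hF hcard hG h3
  have hG5 := h4 hG h3
  obtain ⟨-, hpos, -⟩ := h.resolve_left (by omega)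
  obtain ⟨u, hu⟩ := exists_of_cutCount_pos hpos
  rw [← inter_insert_zero_eq_cutPart h0 u] at hu
  have hsum := sum_neg_one_pow_mul_signCoeff_sq (hF.not_inter_subset u)
    (inter_subset_right (s₁ := G))
  have hterm : ∀ H : Finset (Fin n → ZMod 2),
      H ∩ insert 0 ({v | u ⬝ᵥ v = 1} : Finset (Fin n → ZMod 2)) =
        G ∩ insert 0 ({v | u ⬝ᵥ v = 1} : Finset (Fin n → ZMod 2)) →
      (-1) ^ #H * signCoeff F H ^ 2 = -signCoeff F H ^ 2 := by
    intro H hH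
    by_cases hz : signCoeff F H = 0
    · simp [hz]
    · have hle := card_le_card (inter_subset_left (s₁ := H)
        (s₂ := insert 0 ({v | u ⬝ᵥ v = 1} : Finset (Fin n → ZMod 2))))
      rw [hH, hu] at hle
      rw [h4 hz (by omega)]
      norm_num
  rw [sum_congr rfl fun H hH => hterm H (mem_filter.mp hH).2, sum_neg_distrib, neg_eq_zero,
    sum_eq_zero_iff_of_nonneg fun _ _ => sq_nonneg _] at hsum
  exact hG (pow_eq_zero_iff two_ne_zero |>.mp (hsum G (by simp)))

/-- An odd-linear-dependency-intersecting up-set of measure `1 / 8` is a Schur-umvirate. -/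
lemma OddLDIntersecting.schurUmvirate (hF : OddLDIntersecting n F)
    (hup : ∀ S ∈ F, ∀ T, S ⊆ T → T ∈ F) (hcard : 8 * #F = 2 ^ 2 ^ n) : SchurUmvirate n F := by
  have hne : F.Nonempty := by
    rw [nonempty_iff_ne_empty]
    rintro rfl
    simp at hcard
    exact absurd hcard.symm (by positivity)
  obtain ⟨K, hKmin⟩ := F.exists_minimal hne
  have hK := hKmin.prop
  obtain ⟨G, hG, hKG⟩ := exists_signCoeff_ne_zero_of_minimal hK
    fun T hT hTK => le_antisymm hTK (hKmin.le_of_le hT hTK)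
  have hK3 : #K ≤ 3 := (card_le_card hKG).trans (card_le_three_of_signCoeff_ne_zero hF hcard hG)
  obtain ⟨l, v, hinj, hv0, hvK, hsum⟩ := hF K hK K hK
  rw [inter_self] at hvK
  have himg : univ.image v ⊆ K := by
    intro w hw
    obtain ⟨i, -, rfl⟩ := mem_image.mp hw
    exact hvK i
  have hl : 2 * l + 1 ≤ #K := by
    simpa [card_image_of_injective _ hinj] using card_le_card himg
  obtain rfl | rfl : l = 0 ∨ l = 1 := by omega
  · exact absurd (by simpa using hsum) (hv0 0)
  have hKeq : univ.image v = K :=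
    eq_of_subset_of_card_le himg (by simpa [card_image_of_injective _ hinj] using hK3)
  have hsum' : v 0 + v 1 + v 2 = 0 := by simpa [Fin.sum_univ_three] using hsum
  have hv2 : v 2 = v 0 + v 1 :=
    funext fun i => (CharTwo.add_eq_zero.mp (congrFun hsum' i)).symm
  refine ⟨v 0, v 1, hv0 0, hv0 1, hinj.ne (by decide), hv2 ▸ hv0 2, ?_⟩
  have hKtriple : ({v 0, v 1, v 0 + v 1} : Finset (Fin n → ZMod 2)) = K := by
    rw [← hKeq, ← hv2]
    ext w
    simp [Fin.exists_fin_succ, eq_comm]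
  rw [hKtriple, powerset_univ]
  refine (eq_of_subset_of_card_le (fun S hS => hup K hK S (mem_filter.mp hS).2) ?_).symm
  rw [card_superset, card_vectors]
  have hK3' : #K = 3 := by omega
  have h3 : 3 ≤ 2 ^ n := hK3' ▸ (card_le_univ K).trans_eq card_vectors
  rw [hK3']
  have : 2 ^ 2 ^ n = 8 * 2 ^ (2 ^ n - 3) := by
    rw [show 8 = 2 ^ 3 from rfl, ← pow_add]
    congr 1
    omega
  omega

end UniformMeasure

section BiasedMeasure

variable {n : ℕ} {F : Finset (Finset (Fin n → ZMod 2))}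

/-- The family of supersets of members of `F`. -/
def upFamily (F : Finset (Finset (Fin n → ZMod 2))) : Finset (Finset (Fin n → ZMod 2)) :=
  {T | ∃ S ∈ F, S ⊆ T}

lemma mem_upFamily {T : Finset (Fin n → ZMod 2)} : T ∈ upFamily F ↔ ∃ S ∈ F, S ⊆ T := by
  simp [upFamily]

lemma subset_upFamily : F ⊆ upFamily F :=
  fun S hS => mem_upFamily.mpr ⟨S, hS, Subset.rfl⟩

lemma upFamily_upward {S T : Finset (Fin n → ZMod 2)} (hS : S ∈ upFamily F) (hST : S ⊆ T) :
    T ∈ upFamily F := by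
  obtain ⟨R, hR, hRS⟩ := mem_upFamily.mp hS
  exact mem_upFamily.mpr ⟨R, hR, hRS.trans hST⟩

lemma OddLDIntersecting.upFamily (hF : OddLDIntersecting n F) :
    OddLDIntersecting n (upFamily F) := by
  intro S hS T hT
  obtain ⟨S', hS', hSS⟩ := mem_upFamily.mp hS
  obtain ⟨T', hT', hTT⟩ := mem_upFamily.mp hT
  obtain ⟨l, v, hinj, hv0, hv, hsum⟩ := hF S' hS' T' hT'
  exact ⟨l, v, hinj, hv0, fun i => inter_subset_inter hSS hTT (hv i), hsum⟩

lemma muPFam_eq_biasedMean (p : ℝ) :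
    muPFam n p F = biasedMean p univ fun S => if S ∈ F then 1 else 0 := by
  simp [muPFam, muPSet, biasedMean]

lemma muPFam_half : muPFam n (1 / 2) F = #F / 2 ^ 2 ^ n := by
  have h : ∀ S ∈ F, muPSet n (1 / 2) S = 1 / 2 ^ 2 ^ n := by
    intro S _
    have hle : #S ≤ 2 ^ n := (card_le_univ S).trans_eq card_vectors
    rw [muPSet, show (1 : ℝ) - 1 / 2 = 1 / 2 by norm_num, ← pow_add, Nat.add_sub_cancel' hle,
      one_div_pow]
  rw [muPFam, sum_congr rfl h, sum_const, nsmul_eq_mul, mul_one_div]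

lemma muPSet_pos {p : ℝ} (hp0 : 0 < p) (hp : p ≤ 1 / 2) (S : Finset (Fin n → ZMod 2)) :
    0 < muPSet n p S := by
  have : 0 < 1 - p := by linarith
  unfold muPSet
  positivity

lemma SchurUmvirate.muPFam_eq (hF : SchurUmvirate n F) (p : ℝ) : muPFam n p F = p ^ 3 := by
  obtain ⟨x, y, hx, hy, hxy, -, rfl⟩ := hF
  have h := sum_superset_biased p ({x, y, x + y} : Finset (Fin n → ZMod 2))
  rw [card_eq_three.mpr ⟨x, y, x + y, hxy, by simpa using hy, by simpa using hx, rfl⟩,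
    card_vectors] at h
  rw [powerset_univ]
  exact h

/-- The passage from the uniform measure to smaller `p` for up-sets. -/
lemma muPFam_le_rpow {p : ℝ} (hp0 : 0 < p) (hp : p ≤ 1 / 2)
    (hup : ∀ S ∈ F, ∀ T, S ⊆ T → T ∈ F) :
    muPFam n p F ≤ muPFam n (1 / 2) F ^ Real.logb (1 / 2) p := by
  have hγ : 1 ≤ Real.logb (1 / 2) p := by
    rw [Real.le_logb_iff_rpow_le_of_base_lt_one (by norm_num) (by norm_num) hp0, Real.rpow_one]
    exact hp
  have hpow : (1 / 2 : ℝ) ^ Real.logb (1 / 2) p = p :=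
    Real.rpow_logb (by norm_num) (by norm_num) hp0
  have hmono : Monotone fun S => if S ∈ F then (1 : ℝ) else 0 := by
    intro S T hST
    dsimp only
    by_cases hS : S ∈ F
    · rw [if_pos hS, if_pos (hup S hS T hST)]
    · rw [if_neg hS]
      split_ifs <;> norm_num
  have h := biasedMean_rpow_le (p := 1 / 2) (by norm_num) (by norm_num) hγ univ
    (fun S => by split_ifs <;> norm_num) hmono
  rw [hpow] at h
  rw [muPFam_eq_biasedMean, muPFam_eq_biasedMean]
  convert h using 3 with S
  split_ifs
  · rw [Real.one_rpow]
  · rw [Real.zero_rpow (by linarith)]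

lemma rpow_logb_half_cube {p : ℝ} (hp0 : 0 < p) :
    (1 / 8 : ℝ) ^ Real.logb (1 / 2) p = p ^ 3 := by
  rw [show (1 / 8 : ℝ) = (1 / 2) ^ 3 by norm_num, ← Real.rpow_pow_comm (by norm_num),
    Real.rpow_logb (by norm_num) (by norm_num) hp0]

lemma muPFam_half_nonneg : 0 ≤ muPFam n (1 / 2) F := by
  rw [muPFam_half]
  positivity

lemma OddLDIntersecting.muPFam_half_le (hF : OddLDIntersecting n F) :
    muPFam n (1 / 2) F ≤ 1 / 8 := by
  have h : (8 : ℝ) * #F ≤ 2 ^ 2 ^ n := by exact_mod_cast hF.eight_mul_card_le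
  rw [muPFam_half, div_le_div_iff₀ (by positivity) (by norm_num)]
  linarith

lemma OddLDIntersecting.muPFam_upFamily_le (hF : OddLDIntersecting n F) {p : ℝ} (hp0 : 0 < p)
    (hp : p ≤ 1 / 2) : muPFam n p (_root_.upFamily F) ≤ p ^ 3 := by
  rw [← rpow_logb_half_cube hp0]
  refine (muPFam_le_rpow hp0 hp fun S hS T => upFamily_upward hS).trans ?_
  exact Real.rpow_le_rpow muPFam_half_nonneg hF.upFamily.muPFam_half_le
    <| Real.logb_nonneg_of_base_lt_one (by norm_num) (by norm_num) hp0 (by linarith)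

lemma OddLDIntersecting.eq_upFamily_of_muPFam_eq (hF : OddLDIntersecting n F) {p : ℝ}
    (hp0 : 0 < p) (hp : p ≤ 1 / 2) (heq : muPFam n p F = p ^ 3) : F = _root_.upFamily F := by
  by_contra hne
  obtain ⟨T, hT, hTF⟩ := exists_of_ssubset (ssubset_of_subset_of_ne subset_upFamily hne)
  have hlt : muPFam n p F < muPFam n p (_root_.upFamily F) :=
    sum_lt_sum_of_subset subset_upFamily hT hTF (muPSet_pos hp0 hp T)
      fun S _ _ => (muPSet_pos hp0 hp S).le
  linarith [hF.muPFam_upFamily_le hp0 hp]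

lemma OddLDIntersecting.schurUmvirate_of_muPFam_eq (hF : OddLDIntersecting n F) {p : ℝ}
    (hp0 : 0 < p) (hp : p ≤ 1 / 2) (heq : muPFam n p F = p ^ 3) : SchurUmvirate n F := by
  have hFup := hF.eq_upFamily_of_muPFam_eq hp0 hp heq
  have hup : ∀ S ∈ F, ∀ T, S ⊆ T → T ∈ F := fun S hS T hST => by
    rw [hFup] at hS ⊢
    exact upFamily_upward hS hST
  refine hF.schurUmvirate hup (le_antisymm hF.eight_mul_card_le ?_)
  have hlog := Real.logb_pos_of_base_lt_one (b := 1 / 2) (by norm_num) (by norm_num) hp0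
    (by linarith)
  have hle := muPFam_le_rpow hp0 hp hup
  rw [heq, ← rpow_logb_half_cube hp0, Real.rpow_le_rpow_iff (by norm_num) muPFam_half_nonneg hlog,
    muPFam_half, le_div_iff₀ (by positivity)] at hle
  have h : (2 : ℝ) ^ 2 ^ n ≤ 8 * #F := by
    rw [one_div_mul_eq_div, div_le_iff₀ (by norm_num)] at hle
    rwa [mul_comm] at hle
  exact_mod_cast h

end BiasedMeasure

theorem odd_LD_intersecting_measure_bound
    (n : ℕ) (hn : 2 ≤ n) (p : ℝ) (hp0 : 0 < p) (hp : p ≤ 1 / 2)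
    (F : Finset (Finset (Fin n → ZMod 2)))
    (hInt : OddLDIntersecting n F) :
    muPFam n p F ≤ p ^ 3 ∧ (muPFam n p F = p ^ 3 ↔ SchurUmvirate n F) := by
  refine ⟨?_, hInt.schurUmvirate_of_muPFam_eq hp0 hp, fun h => h.muPFam_eq p⟩
  refine le_trans ?_ (hInt.muPFam_upFamily_le hp0 hp)
  exact sum_le_sum_of_subset_of_nonneg subset_upFamily fun S _ _ => (muPSet_pos hp0 hp S).le
end

section
/- Let n ∈ ℕ, let G ⊆ E_n be a graph with an odd number of edges, and set f(G) = q_0(G) − (5/7)·q_1(G) − (1/7)·q_2(G) + (3/28)·q_3(G). Then f(G) ≤ 1/7, with equality if and only if G is a single edge, a triangle, or isomorphic to K_4^− (the graph on four vertices with five edges). Moreover, if G is none of these, then f(G) ≤ 1/7 − 1/56. -/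
/-- The edge set of the complete graph `K_n` on vertex set `Fin n`:
all non-diagonal unordered pairs. -/
def edgeFinset (n : ℕ) : Finset (Sym2 (Fin n)) :=
  Finset.univ.filter (fun e => ¬ e.IsDiag)

/-- `T` is a triangle: the three edges on three distinct vertices. -/
def IsTriangle {n : ℕ} (T : Finset (Sym2 (Fin n))) : Prop :=
  ∃ a b c : Fin n, a ≠ b ∧ a ≠ c ∧ b ≠ c ∧ T = {s(a, b), s(a, c), s(b, c)}

/-- `G` is (a copy of) `K_4^-`, the complete graph on four vertices minus an edge. -/
def IsK4Minus {n : ℕ} (G : Finset (Sym2 (Fin n))) : Prop :=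
  ∃ a b c d : Fin n, a ≠ b ∧ a ≠ c ∧ a ≠ d ∧ b ≠ c ∧ b ≠ d ∧ c ≠ d ∧
    G = {s(a, b), s(a, c), s(a, d), s(b, c), s(c, d)}

/-- The cut of `G` determined by a two-colouring `c` of the vertices:
the set of edges of `G` with differently-coloured endpoints. -/
def cutOf {n : ℕ} (c : Fin n → Bool) (G : Finset (Sym2 (Fin n))) :
    Finset (Sym2 (Fin n)) :=
  G.filter fun e =>
    Sym2.lift ⟨fun i j => xor (c i) (c j), fun _ _ => Bool.xor_comm _ _⟩ e = true

/-- `q_k(G)`: the probability, over a uniformly random `c : [n] → {0,1}`,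
that the cut of `G` determined by `c` has exactly `k` edges. -/
noncomputable def qk (n : ℕ) (k : ℕ) (G : Finset (Sym2 (Fin n))) : ℝ :=
  ((Finset.univ.filter
      (fun c : Fin n → Bool => (cutOf c G).card = k)).card : ℝ) / 2 ^ n

/-- The spectral weight `f(G) = q_0(G) − (5/7)q_1(G) − (1/7)q_2(G) + (3/28)q_3(G)`. -/
noncomputable def fval (n : ℕ) (G : Finset (Sym2 (Fin n))) : ℝ :=
  qk n 0 G - (5 / 7) * qk n 1 G - (1 / 7) * qk n 2 G + (3 / 28) * qk n 3 G

open Finset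

/-- The number of `a` for which `F a` has exactly `k` coordinates equal to `1`. -/
def weightCount {A ι : Type*} [Fintype A] [Fintype ι] (F : A → ι → ZMod 2) (k : ℕ) : ℕ :=
  #{a | #{i | F a i = 1} = k}

/-- The combination of weight frequencies of `F` that specializes to `fval` on cuts. -/
noncomputable def spectralWeight {A ι : Type*} [Fintype A] [Fintype ι]
    (F : A → ι → ZMod 2) : ℝ :=
  (weightCount F 0 - 5 / 7 * weightCount F 1 - 1 / 7 * weightCount F 2
    + 3 / 28 * weightCount F 3) / Fintype.card A

section LinearAlgebra

variable {A B ι : Type*} [AddCommGroup A] [AddCommGroup B] [Module (ZMod 2) A]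
  [Module (ZMod 2) B] [Fintype A] [Fintype B] [Fintype ι]

theorem card_filter_comp_of_surjective [DecidableEq B] (h : A →ₗ[ZMod 2] B)
    (hh : Function.Surjective h) (P : B → Prop) [DecidablePred P] :
    #{a | P (h a)} = #{b | P b} * #{a | h a = 0} := by
  rw [card_eq_sum_card_fiberwise (f := h) (t := {b | P b}) (fun a ha => by simpa using ha),
    ← smul_eq_mul, ← sum_const]
  refine sum_congr rfl fun b hb => ?_
  rw [filter_filter,
    ← AddMonoidHom.card_fiber_eq_of_mem_range h (x := b) (hh b) (hh 0)]
  congr 1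
  ext a
  simp only [mem_filter, mem_univ, true_and] at hb ⊢
  constructor
  · exact And.right
  · rintro rfl
    exact ⟨hb, rfl⟩

theorem spectralWeight_comp_of_surjective (h : A →ₗ[ZMod 2] B)
    (hh : Function.Surjective h) (F : B → ι → ZMod 2) :
    spectralWeight (fun a => F (h a)) = spectralWeight F := by
  classical
  have hcard : Fintype.card A = Fintype.card B * #{a | h a = 0} := by
    simpa using card_filter_comp_of_surjective h hh (fun _ => True)
  have hpos : (0 : ℝ) < #{a | h a = 0} := by
    exact_mod_cast card_pos.2 ⟨0, by simp⟩
  have hB : (0 : ℝ) < Fintype.card B := by exact_mod_cast Fintype.card_pos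
  have hw (k : ℕ) : weightCount (fun a => F (h a)) k = weightCount F k * #{a | h a = 0} :=
    card_filter_comp_of_surjective h hh (fun b => #{i | F b i = 1} = k)
  simp only [spectralWeight, hw, hcard]
  push_cast
  field_simp

theorem two_mul_card_filter_eq_one_le (p : A →ₗ[ZMod 2] ZMod 2) :
    2 * #{a | p a = 1} ≤ Fintype.card A := by
  classical
  by_cases h : ∃ a, p a = 1
  · obtain ⟨a₀, h₀⟩ := h
    have hp : #{a | p a = 1} = #{a | ¬ p a = 1} := by
      refine card_bij' (fun a _ => a + a₀) (fun a _ => a - a₀) ?_ ?_ ?_ ?_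
      · intro a ha
        simp only [mem_filter, mem_univ, true_and] at ha ⊢
        rw [map_add, ha, h₀]
        decide
      · intro a ha
        simp only [mem_filter, mem_univ, true_and] at ha ⊢
        rw [map_sub, h₀]
        revert ha
        generalize p a = x
        revert x
        decide
      · simp
      · simp
    have := card_filter_add_card_filter_not (s := (univ : Finset A)) (fun a => p a = 1)
    rw [card_univ] at this
    omega
  · have : #{a | p a = 1} = 0 := by
      rw [card_eq_zero, filter_eq_empty_iff]
      exact fun a _ ha => h ⟨a, ha⟩
    omega

theorem ZMod.sum_eq_card_filter_eq_one (v : ι → ZMod 2) :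
    ∑ i, v i = (#{i | v i = 1} : ZMod 2) := by
  rw [card_filter, Nat.cast_sum]
  refine sum_congr rfl fun i _ => ?_
  generalize v i = x
  revert x
  decide

theorem two_mul_weightCount_three_le (F : A →ₗ[ZMod 2] ι → ZMod 2) :
    2 * weightCount F 3 ≤ Fintype.card A := by
  classical
  let p : A →ₗ[ZMod 2] ZMod 2 := ∑ i, LinearMap.proj i ∘ₗ F
  refine le_trans (Nat.mul_le_mul_left 2 (card_le_card ?_)) (two_mul_card_filter_eq_one_le p)
  intro a ha
  simp only [mem_filter, mem_univ, true_and] at ha ⊢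
  have : p a = ∑ i, F a i := by simp [p]
  rw [this, ZMod.sum_eq_card_filter_eq_one, ha]
  decide

theorem weightCount_zero_mul_card_range [DecidableEq ι] (F : A →ₗ[ZMod 2] ι → ZMod 2) :
    weightCount F 0 * 2 ^ Module.finrank (ZMod 2) (LinearMap.range F) = Fintype.card A := by
  classical
  have h := card_filter_comp_of_surjective F.rangeRestrict F.surjective_rangeRestrict
    (fun _ => True)
  have hz : weightCount F 0 = #{a | F.rangeRestrict a = 0} := by
    unfold weightCount
    congr 1
    ext a
    simp only [mem_filter, mem_univ, true_and, card_eq_zero, filter_eq_empty_iff,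
      forall_const, ← Subtype.coe_inj, ZeroMemClass.coe_zero, funext_iff, Pi.zero_apply]
    refine forall_congr' fun i => ?_
    change ¬ F a i = 1 ↔ F a i = 0
    generalize F a i = x
    revert x
    decide
  have hc := Module.card_eq_pow_finrank (K := ZMod 2) (V := LinearMap.range F)
  rw [ZMod.card] at hc
  rw [hz, ← hc, mul_comm]
  simpa using h.symm

theorem spectralWeight_le_of_four_le_finrank [DecidableEq ι] (F : A →ₗ[ZMod 2] ι → ZMod 2)
    (hF : 4 ≤ Module.finrank (ZMod 2) (LinearMap.range F)) :
    spectralWeight F ≤ 1 / 8 := by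
  have h0 : 16 * weightCount F 0 ≤ Fintype.card A := by
    rw [← weightCount_zero_mul_card_range F, mul_comm]
    exact Nat.mul_le_mul_left _ (Nat.pow_le_pow_right (n := 2) two_pos hF)
  have h3 := two_mul_weightCount_three_le F
  have hA : (0 : ℝ) < Fintype.card A := by exact_mod_cast Fintype.card_pos
  rify at h0 h3
  rw [spectralWeight, div_le_iff₀ hA]
  have h1 : (0 : ℝ) ≤ weightCount F 1 := by positivity
  have h2 : (0 : ℝ) ≤ weightCount F 2 := by positivity
  linarith

/-- The weight frequencies of the code on `F₂³` whose coordinate functionals are `T`. -/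
def cubeWeightCount (T : Finset (Fin 3 → ZMod 2)) (k : ℕ) : ℕ :=
  #{y : Fin 3 → ZMod 2 | #{s ∈ T | s ⬝ᵥ y = 1} = k}

theorem cubeWeightCount_bound :
    ∀ T ∈ (univ.erase (0 : Fin 3 → ZMod 2)).powerset, Odd #T →
      ((#T = 1 ∨ (#T = 3 ∧ ∑ s ∈ T, s = 0) ∨ #T = 5) →
        28 * cubeWeightCount T 0 + 3 * cubeWeightCount T 3 =
          32 + 20 * cubeWeightCount T 1 + 4 * cubeWeightCount T 2) ∧
      (¬ (#T = 1 ∨ (#T = 3 ∧ ∑ s ∈ T, s = 0) ∨ #T = 5) →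
        28 * cubeWeightCount T 0 + 3 * cubeWeightCount T 3 ≤
          28 + 20 * cubeWeightCount T 1 + 4 * cubeWeightCount T 2) := by
  decide +kernel

/-- Five points of the Fano plane form two lines sharing a point. -/
theorem exists_eq_two_lines_of_card_eq_five :
    ∀ T ∈ (univ.erase (0 : Fin 3 → ZMod 2)).powerset, #T = 5 →
      ∃ x y z : Fin 3 → ZMod 2, T = {x, y, x + y, z, x + z} := by
  decide +kernel

theorem exists_surjective_of_finrank_le_three
    (hB : Module.finrank (ZMod 2) B ≤ 3) :
    ∃ f : (Fin 3 → ZMod 2) →ₗ[ZMod 2] B, Function.Surjective f := by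
  obtain ⟨g, hg⟩ := (finrank_le_iff_exists_linearMap (R := ZMod 2) (M := B)
    (M' := Fin 3 → ZMod 2)).1 (by simpa using hB)
  obtain ⟨f, hf⟩ := g.exists_leftInverse_of_injective (LinearMap.ker_eq_bot.2 hg)
  exact ⟨f, fun b => ⟨g b, LinearMap.congr_fun hf b⟩⟩

/-- A system of nonzero, pairwise distinct functionals of rank at most three embeds in `F₂³`. -/
theorem exists_cube_embedding [DecidableEq ι] (F : A →ₗ[ZMod 2] ι → ZMod 2)
    (hF : Module.finrank (ZMod 2) (LinearMap.range F) ≤ 3)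
    (hne : ∀ i, ∃ a, F a i ≠ 0) (hinj : ∀ i j, (∀ a, F a i = F a j) → i = j) :
    ∃ s : ι → Fin 3 → ZMod 2, Function.Injective s ∧
      univ.image s ∈ (univ.erase (0 : Fin 3 → ZMod 2)).powerset ∧
      (∀ a, ∃ y, ∀ i, F a i = s i ⬝ᵥ y) ∧ (∀ y, ∃ a, ∀ i, F a i = s i ⬝ᵥ y) ∧
      spectralWeight F = spectralWeight (fun y i => s i ⬝ᵥ y) := by
  classical
  obtain ⟨g, hg⟩ := exists_surjective_of_finrank_le_three hF
  let s : ι → Fin 3 → ZMod 2 := fun i k => (g (Pi.single k 1) : ι → ZMod 2) i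
  have hs (y : Fin 3 → ZMod 2) (i : ι) : (g y : ι → ZMod 2) i = s i ⬝ᵥ y := by
    conv_lhs => rw [pi_eq_sum_univ' y]
    simp [s, dotProduct, mul_comm]
  have hex (a : A) : ∃ y, ∀ i, F a i = s i ⬝ᵥ y := by
    obtain ⟨y, hy⟩ := hg (F.rangeRestrict a)
    exact ⟨y, fun i => by rw [← hs, hy]; rfl⟩
  have hey (y : Fin 3 → ZMod 2) : ∃ a, ∀ i, F a i = s i ⬝ᵥ y := by
    obtain ⟨a, ha⟩ := F.surjective_rangeRestrict (g y)
    exact ⟨a, fun i => by rw [← hs, ← ha]; rfl⟩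
  refine ⟨s, fun i j hij => hinj i j fun a => ?_, ?_, hex, hey, ?_⟩
  · obtain ⟨y, hy⟩ := hex a
    rw [hy, hy, hij]
  · simp only [mem_powerset, subset_iff, mem_image, mem_univ, true_and, mem_erase, and_true]
    rintro _ ⟨i, rfl⟩ h0
    obtain ⟨a, ha⟩ := hne i
    obtain ⟨y, hy⟩ := hex a
    exact ha (by rw [hy, h0, zero_dotProduct])
  · simp_rw [← hs]
    exact (spectralWeight_comp_of_surjective F.rangeRestrict F.surjective_rangeRestrict
      (fun v => (v : ι → ZMod 2))).trans (spectralWeight_comp_of_surjective g hg _).symm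

theorem spectralWeight_dotProduct_eq {s : ι → Fin 3 → ZMod 2} (hs : Function.Injective s) :
    spectralWeight (fun y i => s i ⬝ᵥ y) =
      (28 * cubeWeightCount (univ.image s) 0 + 3 * cubeWeightCount (univ.image s) 3
        - 20 * cubeWeightCount (univ.image s) 1 - 4 * cubeWeightCount (univ.image s) 2 : ℝ)
        / 224 := by
  have h (k : ℕ) : weightCount (fun y i => s i ⬝ᵥ y) k = cubeWeightCount (univ.image s) k := by
    simp only [weightCount, cubeWeightCount, filter_image, card_image_of_injective _ hs]
  have hc : Fintype.card (Fin 3 → ZMod 2) = 8 := by simp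
  simp only [spectralWeight, h, hc]
  push_cast
  ring

theorem spectralWeight_of_finrank_le_three [DecidableEq ι] (F : A →ₗ[ZMod 2] ι → ZMod 2)
    (hF : Module.finrank (ZMod 2) (LinearMap.range F) ≤ 3)
    (hne : ∀ i, ∃ a, F a i ≠ 0) (hinj : ∀ i j, (∀ a, F a i = F a j) → i = j)
    (hodd : Odd (Fintype.card ι)) :
    ((Fintype.card ι = 1 ∨ (Fintype.card ι = 3 ∧ ∀ a, ∑ i, F a i = 0) ∨ Fintype.card ι = 5) →
      spectralWeight F = 1 / 7) ∧
    (¬ (Fintype.card ι = 1 ∨ (Fintype.card ι = 3 ∧ ∀ a, ∑ i, F a i = 0) ∨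
      Fintype.card ι = 5) → spectralWeight F ≤ 1 / 8) := by
  obtain ⟨s, hs, hT, hex, hey, hw⟩ := exists_cube_embedding F hF hne hinj
  have hsum : ∑ i, s i = 0 ↔ ∀ a, ∑ i, F a i = 0 := by
    constructor
    · intro h a
      obtain ⟨y, hy⟩ := hex a
      simp_rw [hy]
      rw [← sum_dotProduct, h, zero_dotProduct]
    · intro h
      refine dotProduct_eq_zero _ fun y => ?_
      obtain ⟨a, ha⟩ := hey y
      rw [sum_dotProduct, ← h a]
      exact sum_congr rfl fun i _ => (ha i).symm
  have hb := cubeWeightCount_bound _ hT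
  rw [card_image_of_injective _ hs, card_univ, sum_image hs.injOn, hsum] at hb
  obtain ⟨h1, h2⟩ := hb hodd
  rw [hw, spectralWeight_dotProduct_eq hs]
  constructor
  · intro h
    have := h1 h
    rify at this
    linarith
  · intro h
    have := h2 h
    rify at this
    linarith

theorem exists_two_lines_of_finrank_le_three [DecidableEq ι] (F : A →ₗ[ZMod 2] ι → ZMod 2)
    (hF : Module.finrank (ZMod 2) (LinearMap.range F) ≤ 3)
    (hne : ∀ i, ∃ a, F a i ≠ 0) (hinj : ∀ i j, (∀ a, F a i = F a j) → i = j)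
    (hcard : Fintype.card ι = 5) :
    ∃ x y u z v : ι, univ = {x, y, u, z, v} ∧
      (∀ a, F a u = F a x + F a y) ∧ (∀ a, F a v = F a x + F a z) := by
  obtain ⟨s, hs, hT, hex, -, -⟩ := exists_cube_embedding F hF hne hinj
  obtain ⟨x', y', z', h⟩ := exists_eq_two_lines_of_card_eq_five _ hT
    (by rw [card_image_of_injective _ hs, card_univ, hcard])
  have hmem (w : Fin 3 → ZMod 2) (hw : w ∈ univ.image s) : ∃ i, s i = w := by simpa using hw
  obtain ⟨x, rfl⟩ := hmem x' (by simp [h])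
  obtain ⟨y, rfl⟩ := hmem y' (by simp [h])
  obtain ⟨u, hu⟩ := hmem (s x + s y) (by simp [h])
  obtain ⟨z, rfl⟩ := hmem z' (by simp [h])
  obtain ⟨v, hv⟩ := hmem (s x + s z) (by simp [h])
  have huniv : univ = ({x, y, u, z, v} : Finset ι) := by
    refine image_injective hs ?_
    simp [h, image_insert, hu, hv]
  have key {p q r : ι} (hr : s r = s p + s q) (a : A) : F a r = F a p + F a q := by
    obtain ⟨w, hw⟩ := hex a
    rw [hw, hw, hw, hr, add_dotProduct]
  exact ⟨x, y, u, z, v, huniv, key hu, key hv⟩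

end LinearAlgebra

section Cuts

/-- The `F₂`-valued difference of a vertex colouring along an edge. -/
def edgeDiff {V : Type*} (c : V → ZMod 2) : Sym2 V → ZMod 2 :=
  Sym2.lift ⟨fun i j => c i + c j, fun _ _ => add_comm _ _⟩

@[simp]
theorem edgeDiff_mk {V : Type*} (c : V → ZMod 2) (i j : V) : edgeDiff c s(i, j) = c i + c j :=
  rfl

variable {n : ℕ}

/-- The linear map sending a vertex colouring to the indicator of its cut of `G`. -/
def cutMap (G : Finset (Sym2 (Fin n))) : (Fin n → ZMod 2) →ₗ[ZMod 2] G → ZMod 2 where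
  toFun c e := edgeDiff c e
  map_add' c d := by
    funext ⟨e, he⟩
    induction e with | _ i j => simp; ring
  map_smul' r c := by
    funext ⟨e, he⟩
    induction e with | _ i j => simp; ring

@[simp]
theorem cutMap_apply (G : Finset (Sym2 (Fin n))) (c : Fin n → ZMod 2) (e : G) :
    cutMap G c e = edgeDiff c e :=
  rfl

/-- Boolean colourings as `F₂`-valued colourings. -/
def boolColoringEquiv (n : ℕ) : (Fin n → Bool) ≃ (Fin n → ZMod 2) :=
  Equiv.arrowCongr (Equiv.refl _) finTwoEquiv.symm

theorem card_cutOf (G : Finset (Sym2 (Fin n))) (c : Fin n → Bool) :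
    #(cutOf c G) = #{e : G | cutMap G (boolColoringEquiv n c) e = 1} := by
  rw [← card_map (Function.Embedding.subtype (· ∈ G))]
  congr 1
  ext e
  simp only [cutOf, mem_filter, mem_map, mem_univ, true_and,
    Function.Embedding.subtype_apply, Subtype.exists, exists_and_right, exists_eq_right]
  rw [← exists_prop]
  refine exists_congr fun _ => ?_
  induction e with | _ i j =>
    change (c i ^^ c j) = true ↔ (finTwoEquiv.symm (c i) + finTwoEquiv.symm (c j) : ZMod 2) = 1
    generalize c i = x, c j = y
    revert x y
    decide

theorem fval_eq_spectralWeight (G : Finset (Sym2 (Fin n))) :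
    fval n G = spectralWeight (cutMap G) := by
  have h (k : ℕ) : qk n k G = weightCount (cutMap G) k / 2 ^ n := by
    simp only [qk, weightCount, card_cutOf]
    congr 2
    exact card_equiv (boolColoringEquiv n)
      (by simp only [mem_filter, mem_univ, true_and, implies_true])
  have hc : Fintype.card (Fin n → ZMod 2) = 2 ^ n := by simp
  simp only [fval, h, spectralWeight, hc]
  push_cast
  ring

theorem exists_edgeDiff_ne_zero {V : Type*} {e : Sym2 V} (he : ¬ e.IsDiag) :
    ∃ c : V → ZMod 2, edgeDiff c e ≠ 0 := by
  classical
  induction e with | _ i j =>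
    refine ⟨Pi.single i 1, ?_⟩
    have : j ≠ i := fun h => he (by simp [h])
    simp [this]

/-- Edges whose differences sum to zero for every colouring form a triangle. -/
theorem exists_triangle_of_edgeDiff {V : Type*} {a b : V} {f g : Sym2 V} (hab : a ≠ b)
    (hf : ¬ f.IsDiag) (hg : ¬ g.IsDiag)
    (h : ∀ c : V → ZMod 2, edgeDiff c g = edgeDiff c s(a, b) + edgeDiff c f) :
    ∃ d, d ≠ a ∧ d ≠ b ∧ ((f = s(a, d) ∧ g = s(d, b)) ∨ (f = s(d, b) ∧ g = s(a, d))) := by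
  classical
  induction f with | _ x y =>
  induction g with | _ z w =>
    have key (v : V) := h (Pi.single v 1)
    simp only [edgeDiff_mk, Pi.single_apply] at key
    have h0 : (0 : ZMod 2) ≠ 1 := by decide
    have h2 : (1 : ZMod 2) + 1 = 0 := by decide
    simp only [Sym2.mk_isDiag_iff] at hf hg
    have ka := key a
    have kb := key b
    have kx := key x
    have ky := key y
    have kz := key z
    have kw := key w
    clear key h
    have : x = a ∨ y = a ∨ x = b ∨ y = b := by grind
    simp only [Sym2.eq_iff]
    rcases this with rfl | rfl | rfl | rfl
    · exact ⟨y, by grind⟩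
    · exact ⟨x, by grind⟩
    · exact ⟨y, by grind⟩
    · exact ⟨x, by grind⟩

theorem edge_ext_of_edgeDiff {V : Type*} {e f : Sym2 V} (he : ¬ e.IsDiag) (hf : ¬ f.IsDiag)
    (h : ∀ c : V → ZMod 2, edgeDiff c e = edgeDiff c f) : e = f := by
  classical
  induction e with | _ x y =>
  induction f with | _ z w =>
    have key (v : V) := h (Pi.single v 1)
    simp only [edgeDiff_mk, Pi.single_apply] at key
    have h0 : (0 : ZMod 2) ≠ 1 := by decide
    have h2 : (1 : ZMod 2) + 1 = 0 := by decide
    simp only [Sym2.mk_isDiag_iff] at he hf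
    have kx := key x
    have ky := key y
    grind

theorem isTriangle_iff {G : Finset (Sym2 (Fin n))} (hG : G ⊆ edgeFinset n) :
    IsTriangle G ↔ #G = 3 ∧ ∀ c : Fin n → ZMod 2, ∑ e ∈ G, edgeDiff c e = 0 := by
  constructor
  · rintro ⟨a, b, c, hab, hac, hbc, rfl⟩
    have h1 : s(a, b) ∉ ({s(a, c), s(b, c)} : Finset (Sym2 (Fin n))) := by
      simp; grind
    have h2 : s(a, c) ≠ s(b, c) := by simp; grind
    refine ⟨by rw [card_insert_of_notMem h1, card_pair h2], fun d => ?_⟩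
    rw [sum_insert h1, sum_pair h2]
    simp only [edgeDiff_mk]
    generalize d a = x, d b = y, d c = z
    revert x y z
    decide
  · rintro ⟨h3, hs⟩
    obtain ⟨e, f, g, hef, heg, hfg, rfl⟩ := card_eq_three.1 h3
    have hnd : ∀ x ∈ ({e, f, g} : Finset (Sym2 (Fin n))), ¬ x.IsDiag :=
      fun x hx => by simpa [edgeFinset] using hG hx
    induction e with | _ a b =>
    have hab : a ≠ b := by simpa using hnd s(a, b) (by simp)
    obtain ⟨d, hda, hdb, h⟩ := exists_triangle_of_edgeDiff hab (hnd f (by simp))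
      (hnd g (by simp)) fun c => by
        have := hs c
        rw [sum_insert (by simp [hef, heg]), sum_pair hfg] at this
        revert this
        generalize edgeDiff c s(a, b) = x, edgeDiff c f = y, edgeDiff c g = z
        revert x y z
        decide
    refine ⟨a, b, d, hab, hda.symm, hdb.symm, ?_⟩
    obtain ⟨rfl, rfl⟩ | ⟨rfl, rfl⟩ := h
    · rw [Sym2.eq_swap (a := d)]
    · rw [Sym2.eq_swap (a := d), pair_comm]

theorem isK4Minus_iff {G : Finset (Sym2 (Fin n))} (hG : G ⊆ edgeFinset n) :
    IsK4Minus G ↔ #G = 5 ∧ Module.finrank (ZMod 2) (LinearMap.range (cutMap G)) ≤ 3 := by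
  have hnd : ∀ x ∈ G, ¬ x.IsDiag := fun x hx => by simpa [edgeFinset] using hG hx
  constructor
  · rintro ⟨a, b, c, d, hab, hac, had, hbc, hbd, hcd, rfl⟩
    constructor
    · repeat rw [card_insert_of_notMem (by simp; grind)]
      simp
    · set G : Finset (Sym2 (Fin n)) := {s(a, b), s(a, c), s(a, d), s(b, c), s(c, d)} with hGdef
      let p : (G → ZMod 2) →ₗ[ZMod 2] Fin 3 → ZMod 2 :=
        LinearMap.funLeft _ _ ![⟨s(a, b), by simp [G]⟩, ⟨s(a, c), by simp [G]⟩,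
          ⟨s(a, d), by simp [G]⟩]
      have hp : Function.Injective (p.domRestrict (LinearMap.range (cutMap G))) := by
        rw [← LinearMap.ker_eq_bot, LinearMap.ker_eq_bot']
        rintro ⟨_, x, rfl⟩ h
        have h0 : x a + x b = 0 := congrFun h 0
        have h1 : x a + x c = 0 := congrFun h 1
        have h2 : x a + x d = 0 := congrFun h 2
        ext ⟨e, he⟩
        have hxy (y : ZMod 2) (h : x a + y = 0) : y = x a := by
          revert h
          generalize x a = z
          revert y z
          decide
        have hb := hxy _ h0
        have hc := hxy _ h1
        have hd := hxy _ h2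
        simp only [hGdef, mem_insert, mem_singleton] at he
        rcases he with rfl | rfl | rfl | rfl | rfl <;>
          simp [hb, hc, hd, CharTwo.add_self_eq_zero]
      simpa using LinearMap.finrank_le_finrank_of_injective hp
  · rintro ⟨h5, hr⟩
    obtain ⟨⟨e, he⟩, ⟨f, hf⟩, ⟨f', hf'⟩, ⟨g, hg⟩, ⟨g', hg'⟩, huniv, h1, h2⟩ :=
      exists_two_lines_of_finrank_le_three (cutMap G) hr
        (fun i => exists_edgeDiff_ne_zero (hnd _ i.2))
        (fun i j h => Subtype.ext (edge_ext_of_edgeDiff (hnd _ i.2) (hnd _ j.2) h))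
        (by simpa using h5)
    have hGe : G = {e, f, f', g, g'} := by
      have := congrArg (image Subtype.val) huniv
      simpa [univ_eq_attach, image_insert] using this
    induction e with | _ a c =>
    have hac : a ≠ c := by simpa using hnd _ he
    obtain ⟨b, hba, hbc, hb⟩ := exists_triangle_of_edgeDiff hac (hnd f hf) (hnd f' hf') h1
    obtain ⟨d, hda, hdc, hd⟩ := exists_triangle_of_edgeDiff hac (hnd g hg) (hnd g' hg') h2
    have hG' : G = {s(a, b), s(a, c), s(a, d), s(b, c), s(c, d)} := by
      rw [hGe, Sym2.eq_swap (a := c)]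
      ext x
      simp only [mem_insert, mem_singleton]
      grind
    refine ⟨a, b, c, d, hba.symm, hac, hda.symm, hbc, ?_, hdc.symm, hG'⟩
    rintro rfl
    have h3 : #G ≤ 3 := by
      rw [hG']
      refine (card_le_card (t := {s(a, b), s(a, c), s(b, c)}) ?_).trans card_le_three
      rw [Sym2.eq_swap (a := c)]
      intro x
      simp only [mem_insert, mem_singleton]
      tauto
    omega

end Cuts

theorem fval_odd_bound
    (n : ℕ) (G : Finset (Sym2 (Fin n))) (hG : G ⊆ edgeFinset n)
    (hodd : Odd G.card) :
    fval n G ≤ 1 / 7 ∧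
    (fval n G = 1 / 7 ↔ (G.card = 1 ∨ IsTriangle G ∨ IsK4Minus G)) ∧
    (¬(G.card = 1 ∨ IsTriangle G ∨ IsK4Minus G) → fval n G ≤ 1 / 7 - 1 / 56) := by
  have hnd : ∀ x ∈ G, ¬ x.IsDiag := fun x hx => by simpa [edgeFinset] using hG hx
  have hrank : Module.finrank (ZMod 2) (LinearMap.range (cutMap G)) ≤ #G := by
    simpa using (LinearMap.range (cutMap G)).finrank_le
  suffices h : ((#G = 1 ∨ IsTriangle G ∨ IsK4Minus G) → fval n G = 1 / 7) ∧
      (¬ (#G = 1 ∨ IsTriangle G ∨ IsK4Minus G) → fval n G ≤ 1 / 8) by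
    obtain ⟨h1, h2⟩ := h
    by_cases hc : #G = 1 ∨ IsTriangle G ∨ IsK4Minus G
    · simp [h1 hc, hc]
    · have := h2 hc
      refine ⟨by linarith, iff_of_false (fun h => by linarith) hc, fun _ => by linarith⟩
  rw [fval_eq_spectralWeight, isTriangle_iff hG, isK4Minus_iff hG]
  by_cases hr : Module.finrank (ZMod 2) (LinearMap.range (cutMap G)) ≤ 3
  · have h := spectralWeight_of_finrank_le_three (cutMap G) hr
      (fun i => exists_edgeDiff_ne_zero (hnd _ i.2))
      (fun i j h => Subtype.ext (edge_ext_of_edgeDiff (hnd _ i.2) (hnd _ j.2) h))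
      (by simpa using hodd)
    have hs (c : Fin n → ZMod 2) : ∑ e : G, cutMap G c e = ∑ e ∈ G, edgeDiff c e :=
      sum_coe_sort G (edgeDiff c)
    simpa only [hs, Fintype.card_coe, hr, and_true] using h
  · refine ⟨fun h => absurd h ?_, fun _ =>
      spectralWeight_le_of_four_le_finrank _ (by omega)⟩
    omega
end

section
/- Let n ∈ ℕ, let G ⊆ E_n be a graph with an even number of edges, and set f(G) = q_0(G) − (5/7)·q_1(G) − (1/7)·q_2(G) + (3/28)·q_3(G). Then f(G) ≥ −1/7, with equality if and only if G is a forest (an acyclic graph) with exactly 2 edges or exactly 4 edges. Moreover, if G is not such a forest, then f(G) ≥ −1/7 + 1/28. -/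
/-- The simple graph on `Fin n` with edge set `G`. -/
def graphOf {n : ℕ} (G : Finset (Sym2 (Fin n))) : SimpleGraph (Fin n) :=
  SimpleGraph.fromEdgeSet (G : Set (Sym2 (Fin n)))

/-- `G` is a forest: it contains no cycle. -/
def IsForest {n : ℕ} (G : Finset (Sym2 (Fin n))) : Prop :=
  (graphOf G).IsAcyclic

open Finset in
/-- The coordinates `e` for which `{e}` belongs to the family `C`. -/
def singletonSupport {α : Type*} [DecidableEq α] (C : Finset (Finset α)) : Finset α :=
  (C.filter fun S => #S = 1).biUnion id

section BinaryCode

open Finset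

variable {α : Type*} [DecidableEq α] {C : Finset (Finset α)}

lemma mem_singletonSupport {e : α} : e ∈ singletonSupport C ↔ {e} ∈ C := by
  simp only [singletonSupport, mem_biUnion, mem_filter, id, card_eq_one]
  constructor
  · rintro ⟨S, ⟨hS, a, rfl⟩, he⟩
    rw [mem_singleton] at he
    exact he ▸ hS
  · exact fun h => ⟨{e}, ⟨h, e, rfl⟩, mem_singleton_self e⟩

lemma mem_of_subset_singletonSupport (h0 : ∅ ∈ C)
    (hC : ∀ S ∈ C, ∀ T ∈ C, symmDiff S T ∈ C) {X : Finset α}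
    (hX : X ⊆ singletonSupport C) : X ∈ C := by
  induction X using Finset.induction_on with
  | empty => exact h0
  | insert a X ha ih =>
    have h1 : {a} ∈ C := mem_singletonSupport.1 (hX (mem_insert_self a X))
    have h2 : X ∈ C := ih ((subset_insert a X).trans hX)
    have h3 : symmDiff {a} X = insert a X := by
      ext x
      simp only [mem_symmDiff, mem_singleton, mem_insert]
      grind
    exact h3 ▸ hC _ h1 _ h2

lemma sdiff_singletonSupport_mem (h0 : ∅ ∈ C)
    (hC : ∀ S ∈ C, ∀ T ∈ C, symmDiff S T ∈ C) {S : Finset α} (hS : S ∈ C) :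
    S \ singletonSupport C ∈ C := by
  have h1 : symmDiff S (S ∩ singletonSupport C) = S \ singletonSupport C := by
    ext x
    simp only [mem_symmDiff, mem_inter, mem_sdiff]
    tauto
  exact h1 ▸ hC _ hS _ (mem_of_subset_singletonSupport h0 hC inter_subset_right)

/-- The members of `C` that avoid every coordinate `e` with `{e} ∈ C`. -/
def reducedCode (C : Finset (Finset α)) : Finset (Finset α) :=
  C.filter fun S => Disjoint S (singletonSupport C)

lemma mem_reducedCode {S : Finset α} :
    S ∈ reducedCode C ↔ S ∈ C ∧ Disjoint S (singletonSupport C) := by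
  simp [reducedCode]

lemma symmDiff_mem_reducedCode (hC : ∀ S ∈ C, ∀ T ∈ C, symmDiff S T ∈ C) :
    ∀ S ∈ reducedCode C, ∀ T ∈ reducedCode C, symmDiff S T ∈ reducedCode C := by
  intro S hS T hT
  rw [mem_reducedCode] at *
  refine ⟨hC _ hS.1 _ hT.1, ?_⟩
  have h := hS.2
  have h' := hT.2
  rw [disjoint_left] at *
  intro x hx
  rcases mem_symmDiff.1 hx with hx | hx
  · exact h hx.1
  · exact h' hx.1

lemma card_filter_eq_card_filter_product (h0 : ∅ ∈ C)
    (hC : ∀ S ∈ C, ∀ T ∈ C, symmDiff S T ∈ C) (p : ℕ → Prop) [DecidablePred p] :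
    #(C.filter fun S => p #S) =
      #(((singletonSupport C).powerset ×ˢ reducedCode C).filter
        fun x => p (#x.1 + #x.2)) := by
  set B := singletonSupport C with hB
  refine card_bij' (fun S _ => (S ∩ B, S \ B)) (fun x _ => x.1 ∪ x.2) ?_ ?_ ?_ ?_
  · intro S hS
    rw [mem_filter] at hS
    simp only [mem_filter, mem_product, mem_powerset, mem_reducedCode]
    refine ⟨⟨inter_subset_right, sdiff_singletonSupport_mem h0 hC hS.1, sdiff_disjoint⟩, ?_⟩
    rw [card_inter_add_card_sdiff]
    exact hS.2
  · rintro ⟨X, Y⟩ h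
    simp only [mem_filter, mem_product, mem_powerset, mem_reducedCode] at h ⊢
    obtain ⟨⟨hX, hY, hd⟩, hp⟩ := h
    have hXY : Disjoint X Y := (hd.mono_right hX).symm
    refine ⟨?_, by rwa [card_union_of_disjoint hXY]⟩
    rw [← sup_eq_union, ← hXY.symmDiff_eq_sup]
    exact hC _ (mem_of_subset_singletonSupport h0 hC hX) _ hY
  · intro S _
    exact sup_inf_sdiff S B
  · rintro ⟨X, Y⟩ h
    simp only [mem_filter, mem_product, mem_powerset, mem_reducedCode] at h
    obtain ⟨⟨hX, hY, hd⟩, hp⟩ := h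
    rw [disjoint_left] at hd
    ext x <;> simp <;> grind

lemma card_eq_two_pow_mul (h0 : ∅ ∈ C) (hC : ∀ S ∈ C, ∀ T ∈ C, symmDiff S T ∈ C) :
    #C = 2 ^ #(singletonSupport C) * #(reducedCode C) := by
  have h := card_filter_eq_card_filter_product h0 hC (fun _ => True)
  simpa [card_product] using h

lemma card_filter_card_eq_sum (h0 : ∅ ∈ C) (hC : ∀ S ∈ C, ∀ T ∈ C, symmDiff S T ∈ C)
    (k : ℕ) :
    #(C.filter fun S => #S = k) = ∑ x ∈ antidiagonal k,
      (#(singletonSupport C)).choose x.1 * #((reducedCode C).filter fun S => #S = x.2) := by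
  rw [card_filter_eq_card_filter_product h0 hC (fun m => m = k)]
  rw [card_eq_sum_card_fiberwise (f := fun x => (#x.1, #x.2)) (t := antidiagonal k)]
  · refine sum_congr rfl fun x hx => ?_
    rw [← card_powersetCard, ← card_product]
    congr 1
    ext ⟨X, Y⟩
    rw [HasAntidiagonal.mem_antidiagonal] at hx
    simp only [mem_filter, mem_product, mem_powerset, mem_powersetCard, Prod.ext_iff]
    grind
  · intro x hx
    simpa using (mem_filter.1 hx).2

lemma card_filter_card_eq_zero (h0 : ∅ ∈ C) : #(C.filter fun S => #S = 0) = 1 := by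
  rw [card_eq_one]
  refine ⟨∅, ?_⟩
  ext S
  simp only [mem_filter, card_eq_zero, mem_singleton]
  grind

lemma empty_mem_reducedCode (h0 : ∅ ∈ C) : ∅ ∈ reducedCode C :=
  mem_reducedCode.2 ⟨h0, disjoint_empty_left _⟩

lemma reducedCode_card_ne_one {S : Finset α} (hS : S ∈ reducedCode C) : #S ≠ 1 := by
  intro h
  obtain ⟨a, rfl⟩ := card_eq_one.1 h
  rw [mem_reducedCode] at hS
  exact disjoint_left.1 hS.2 (mem_singleton_self a) (mem_singletonSupport.2 hS.1)

lemma four_le_card_reducedCode (h0 : ∅ ∈ C) (hC : ∀ S ∈ C, ∀ T ∈ C, symmDiff S T ∈ C)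
    {G : Finset α} (hG : ∀ S ∈ C, S ⊆ G)
    (hsep : ∀ e ∈ G, ∀ f ∈ G, e ≠ f → ∃ S ∈ C, e ∈ S ∧ f ∉ S)
    {S : Finset α} (hS : S ∈ C) {e : α} (he : e ∈ S) (heB : e ∉ singletonSupport C) :
    4 ≤ #(reducedCode C) := by
  set B := singletonSupport C with hB
  have hSR : S \ B ∈ reducedCode C :=
    mem_reducedCode.2 ⟨sdiff_singletonSupport_mem h0 hC hS, sdiff_disjoint⟩
  have heS : e ∈ S \ B := mem_sdiff.2 ⟨he, heB⟩
  obtain ⟨f, hf, hfe⟩ : ∃ f ∈ S \ B, f ≠ e := by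
    by_contra! h
    refine reducedCode_card_ne_one hSR (card_eq_one.2 ⟨e, ?_⟩)
    ext x
    grind
  have hfS := mem_sdiff.1 hf
  obtain ⟨T, hT, heT, hfT⟩ := hsep e (hG S hS he) f (hG S hS hfS.1) hfe.symm
  have hTR : T \ B ∈ reducedCode C :=
    mem_reducedCode.2 ⟨sdiff_singletonSupport_mem h0 hC hT, sdiff_disjoint⟩
  have hsub : {∅, S \ B, T \ B, symmDiff (S \ B) (T \ B)} ⊆ reducedCode C := by
    intro X hX
    simp only [mem_insert, mem_singleton] at hX
    rcases hX with rfl | rfl | rfl | rfl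
    · exact empty_mem_reducedCode h0
    · exact hSR
    · exact hTR
    · exact symmDiff_mem_reducedCode hC _ hSR _ hTR
  have heT' : e ∈ T \ B := mem_sdiff.2 ⟨heT, heB⟩
  have hfT' : f ∉ T \ B := fun h => hfT (mem_sdiff.1 h).1
  have heD : e ∉ symmDiff (S \ B) (T \ B) := by
    rw [mem_symmDiff]; tauto
  have hfD : f ∈ symmDiff (S \ B) (T \ B) := by
    rw [mem_symmDiff]; tauto
  refine le_trans (le_of_eq ?_) (card_le_card hsub)
  generalize S \ B = X at *
  generalize T \ B = Y at *
  generalize symmDiff X Y = Z at *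
  have n1 : ∅ ≠ X := by rintro rfl; simp at heS
  have n2 : ∅ ≠ Y := by rintro rfl; simp at heT'
  have n3 : ∅ ≠ Z := by rintro rfl; simp at hfD
  have n4 : X ≠ Y := by rintro rfl; exact hfT' hf
  have n5 : X ≠ Z := by rintro rfl; exact heD heS
  have n6 : Y ≠ Z := by rintro rfl; exact hfT' hfD
  simp [n1, n2, n3, n4, n5, n6]

lemma card_le_four_of_card_le_two (hC : ∀ S ∈ C, ∀ T ∈ C, symmDiff S T ∈ C)
    (hle : ∀ S ∈ C, #S ≤ 2) {w : Finset α} (hw : w ∈ C) (hw2 : #w = 2) : #C ≤ 4 := by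
  have h4 : #w.powerset = 4 := by rw [card_powerset, hw2]; rfl
  rw [← h4]
  refine card_le_card_of_injOn (fun S => S ∩ w) (fun S _ => by simp) ?_
  intro S hS T hT hST
  have hST' : S ∩ w = T ∩ w := hST
  have hd : Disjoint (symmDiff S T) w := by
    rw [disjoint_left]
    intro x hx hxw
    have := congrArg (x ∈ ·) hST'
    simp only [mem_inter, hxw, and_true, eq_iff_iff] at this
    rw [mem_symmDiff] at hx
    tauto
  have h1 := hle _ (hC _ (hC S hS T hT) w hw)
  rw [hd.symmDiff_eq_sup, sup_eq_union, card_union_of_disjoint hd, hw2] at h1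
  have h2 : #(symmDiff S T) = 0 := by omega
  exact symmDiff_eq_bot.1 (card_eq_zero.1 h2)

lemma two_mul_card_filter_card_eq_two_le (hC : ∀ S ∈ C, ∀ T ∈ C, symmDiff S T ∈ C)
    {w : Finset α} (hw : w ∈ C) (hw3 : 3 ≤ #w) :
    2 * #(C.filter fun S => #S = 2) ≤ #C + 6 := by
  set W := C.filter fun S => #S = 2 with hW
  have hA : #(W.filter fun S => symmDiff S w ∉ W) ≤ #(C \ W) := by
    refine card_le_card_of_injOn (fun S => symmDiff S w) ?_ ?_
    · intro S hS
      have hS := mem_filter.1 hS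
      exact mem_sdiff.2 ⟨hC _ (mem_filter.1 hS.1).1 _ hw, hS.2⟩
    · intro S _ T _ h
      exact symmDiff_left_injective w h
  have hB : #(W.filter fun S => symmDiff S w ∈ W) ≤ 6 := by
    have key : ∀ S ∈ W.filter fun S => symmDiff S w ∈ W, S ⊆ w ∧ #w = 4 := by
      intro S hS
      simp only [hW, mem_filter] at hS
      have e1 := card_sdiff_add_card_inter S w
      have e2 := card_sdiff_add_card_inter w S
      have e3 : #(symmDiff S w) = #(S \ w) + #(w \ S) := by
        rw [symmDiff_def, sup_eq_union, card_union_of_disjoint disjoint_sdiff_sdiff]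
      rw [inter_comm] at e2
      have : #(S \ w) = 0 := by omega
      exact ⟨sdiff_eq_empty_iff_subset.1 (card_eq_zero.1 this), by omega⟩
    by_cases h4 : #w = 4
    · have : W.filter (fun S => symmDiff S w ∈ W) ⊆ w.powersetCard 2 := by
        intro S hS
        refine mem_powersetCard.2 ⟨(key S hS).1, ?_⟩
        exact (mem_filter.1 (mem_filter.1 hS).1).2
      refine (card_le_card this).trans ?_
      rw [card_powersetCard, h4]
      decide
    · rw [filter_eq_empty_iff.2 fun S hS h => h4 (key S (mem_filter.2 ⟨hS, h⟩)).2]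
      simp
  have h1 := card_filter_add_card_filter_not (s := W) (fun S => symmDiff S w ∈ W)
  have hWC : W ⊆ C := filter_subset _ _
  have h2 := card_sdiff_add_card_eq_card hWC
  omega

lemma four_mul_card_filter_card_eq_two_le (hC : ∀ S ∈ C, ∀ T ∈ C, symmDiff S T ∈ C) :
    4 * #(C.filter fun S => #S = 2) ≤ 28 + 3 * #C := by
  have hle : #(C.filter fun S => #S = 2) ≤ #C := card_filter_le _ _
  by_cases h3 : ∃ w ∈ C, 3 ≤ #w
  · obtain ⟨w, hw, hw3⟩ := h3
    have := two_mul_card_filter_card_eq_two_le hC hw hw3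
    omega
  · push Not at h3
    rcases (C.filter fun S => #S = 2).eq_empty_or_nonempty with h | ⟨w, hw⟩
    · simp [h]
    · rw [mem_filter] at hw
      have := card_le_four_of_card_le_two hC (fun S hS => Nat.lt_succ_iff.1 (h3 S hS)) hw.1 hw.2
      omega

end BinaryCode

section Arithmetic

lemma two_mul_choose_two_cast (b : ℕ) : 2 * (b.choose 2 : ℝ) = b * (b - 1) := by
  rw [Nat.cast_choose_two]; ring

lemma six_mul_choose_three_cast (b : ℕ) :
    6 * (b.choose 3 : ℝ) = b * (b - 1) * (b - 2) := by
  induction b with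
  | zero => simp
  | succ b ih =>
    have h := two_mul_choose_two_cast b
    rw [Nat.choose_succ_succ' b 2]
    push_cast
    linear_combination ih + 3 * h

lemma forest_weight_nonneg {b : ℕ} (hb : 10 ≤ b) :
    (0 : ℝ) ≤ 28 - 20 * b - 4 * b.choose 2 + 3 * b.choose 3 := by
  have h2 := two_mul_choose_two_cast b
  have h3 := six_mul_choose_three_cast b
  have hb' : (10 : ℝ) ≤ b := by exact_mod_cast hb
  nlinarith [mul_nonneg (sub_nonneg.2 hb') (sub_nonneg.2 hb'),
    mul_nonneg (mul_nonneg (sub_nonneg.2 hb') (sub_nonneg.2 hb')) (sub_nonneg.2 hb')]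

lemma forest_weight_ge (b : ℕ) :
    -(12 * 2 ^ b : ℝ) ≤ 28 - 20 * b - 4 * b.choose 2 + 3 * b.choose 3 := by
  by_cases hb : 10 ≤ b
  · exact le_trans (neg_nonpos.2 (by positivity)) (forest_weight_nonneg hb)
  · push Not at hb
    interval_cases b <;> norm_num [Nat.choose]

lemma forest_weight_ge_of_even {b : ℕ} (hb : Even b) (h2 : b ≠ 2) (h4 : b ≠ 4) :
    -(3 * 2 ^ b : ℝ) ≤ 28 - 20 * b - 4 * b.choose 2 + 3 * b.choose 3 := by
  by_cases hb10 : 10 ≤ b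
  · exact le_trans (neg_nonpos.2 (by positivity)) (forest_weight_nonneg hb10)
  · push Not at hb10
    interval_cases b <;> first
      | exact absurd hb (by decide)
      | exact absurd rfl h2
      | exact absurd rfl h4
      | norm_num [Nat.choose]

lemma nonforest_weight_ge {b p m t : ℕ} (hp : 4 ≤ p) (hmp : m ≤ p)
    (hm : 4 * m ≤ 28 + 3 * p) :
    -(3 * (2 ^ b * p) : ℝ) ≤ 28 - 20 * b - 4 * (b.choose 2 + m) +
      3 * (b.choose 3 + b * m + t) := by
  have ht : (0 : ℝ) ≤ t := t.cast_nonneg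
  have hm0 : (0 : ℝ) ≤ m := m.cast_nonneg
  have hp' : (4 : ℝ) ≤ p := by exact_mod_cast hp
  have hmp' : (m : ℝ) ≤ p := by exact_mod_cast hmp
  have hm' : (4 * m : ℝ) ≤ 28 + 3 * p := by exact_mod_cast hm
  rcases Nat.lt_or_ge b 2 with hb | hb
  · interval_cases b <;> norm_num [Nat.choose] <;> linarith
  · have hb' : (2 : ℝ) ≤ b := by exact_mod_cast hb
    have h := forest_weight_ge b
    have h1 : (2 : ℝ) ^ b * 4 ≤ 2 ^ b * p := by gcongr
    have h2 : 2 * (m : ℝ) ≤ b * m := by gcongr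
    linarith

end Arithmetic

section Cut

open Finset

variable {n : ℕ}

lemma mk_mem_cutOf {c : Fin n → Bool} {G : Finset (Sym2 (Fin n))} {i j : Fin n} :
    s(i, j) ∈ cutOf c G ↔ s(i, j) ∈ G ∧ c i ≠ c j := by
  simp [cutOf]

lemma cutOf_xor (c d : Fin n → Bool) (G : Finset (Sym2 (Fin n))) :
    cutOf (fun i => xor (c i) (d i)) G = symmDiff (cutOf c G) (cutOf d G) := by
  ext e
  induction e using Sym2.ind with
  | _ i j =>
    simp only [mem_symmDiff, mk_mem_cutOf]
    cases c i <;> cases c j <;> cases d i <;> cases d j <;> simp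

/-- The set of all cuts of `G`. -/
def cutSpace (G : Finset (Sym2 (Fin n))) : Finset (Finset (Sym2 (Fin n))) :=
  univ.image fun c => cutOf c G

lemma mem_cutSpace {G S : Finset (Sym2 (Fin n))} :
    S ∈ cutSpace G ↔ ∃ c, cutOf c G = S := by
  simp [cutSpace]

lemma cutOf_const_false (G : Finset (Sym2 (Fin n))) : cutOf (fun _ => false) G = ∅ := by
  ext e
  induction e using Sym2.ind with
  | _ i j => simp [mk_mem_cutOf]

lemma empty_mem_cutSpace (G : Finset (Sym2 (Fin n))) : ∅ ∈ cutSpace G :=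
  mem_cutSpace.2 ⟨_, cutOf_const_false G⟩

lemma symmDiff_mem_cutSpace (G : Finset (Sym2 (Fin n))) :
    ∀ S ∈ cutSpace G, ∀ T ∈ cutSpace G, symmDiff S T ∈ cutSpace G := by
  intro S hS T hT
  obtain ⟨c, rfl⟩ := mem_cutSpace.1 hS
  obtain ⟨d, rfl⟩ := mem_cutSpace.1 hT
  exact mem_cutSpace.2 ⟨_, cutOf_xor c d G⟩

lemma subset_of_mem_cutSpace {G S : Finset (Sym2 (Fin n))} (hS : S ∈ cutSpace G) :
    S ⊆ G := by
  obtain ⟨c, rfl⟩ := mem_cutSpace.1 hS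
  exact filter_subset _ _

lemma card_fiber_cutOf {G S : Finset (Sym2 (Fin n))} (hS : S ∈ cutSpace G) :
    #(univ.filter fun c => cutOf c G = S) = #(univ.filter fun c => cutOf c G = ∅) := by
  obtain ⟨d, rfl⟩ := mem_cutSpace.1 hS
  refine card_bij' (fun c _ i => xor (c i) (d i)) (fun c _ i => xor (c i) (d i)) ?_ ?_ ?_ ?_
  · intro c hc
    simp only [mem_filter, mem_univ, true_and] at hc ⊢
    rw [cutOf_xor, hc, symmDiff_self]
    rfl
  · intro c hc
    simp only [mem_filter, mem_univ, true_and] at hc ⊢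
    rw [cutOf_xor, hc]
    exact bot_symmDiff _
  · intro c _
    simp
  · intro c _
    simp

lemma card_filter_cutOf (G : Finset (Sym2 (Fin n))) (p : ℕ → Prop) [DecidablePred p] :
    #(univ.filter fun c => p #(cutOf c G)) =
      #((cutSpace G).filter fun S => p #S) * #(univ.filter fun c => cutOf c G = ∅) := by
  rw [card_eq_sum_card_fiberwise (f := fun c => cutOf c G)
    (t := (cutSpace G).filter fun S => p #S)]
  · rw [← smul_eq_mul, ← sum_const]
    refine sum_congr rfl fun S hS => ?_
    rw [mem_filter] at hS
    rw [← card_fiber_cutOf hS.1, filter_filter]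
    congr 1
    ext c
    simp only [mem_filter, mem_univ, true_and]
    constructor
    · exact fun h => h.2
    · exact fun h => ⟨h ▸ hS.2, h⟩
  · intro c hc
    have hc := mem_filter.1 hc
    exact mem_filter.2 ⟨mem_cutSpace.2 ⟨c, rfl⟩, hc.2⟩

lemma qk_eq_div_card_cutSpace (k : ℕ) (G : Finset (Sym2 (Fin n))) :
    qk n k G = #((cutSpace G).filter fun S => #S = k) / #(cutSpace G) := by
  have h1 := card_filter_cutOf G (fun m => m = k)
  have h2 := card_filter_cutOf G (fun _ => True)
  simp only [filter_true, card_univ, Fintype.card_fun, Fintype.card_bool, Fintype.card_fin] at h2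
  have h3 : (2 : ℝ) ^ n = #(cutSpace G) * #(univ.filter fun c => cutOf c G = ∅) := by
    exact_mod_cast h2
  have h4 : (#(univ.filter fun c => cutOf c G = ∅) : ℝ) ≠ 0 := by
    intro h
    rw [h, mul_zero] at h3
    exact pow_ne_zero n two_ne_zero h3
  rw [qk, h1, h3, Nat.cast_mul, mul_div_mul_right _ _ h4]

lemma exists_mem_cutSpace_of_ne {G : Finset (Sym2 (Fin n))} (hG : G ⊆ edgeFinset n) :
    ∀ e ∈ G, ∀ f ∈ G, e ≠ f → ∃ S ∈ cutSpace G, e ∈ S ∧ f ∉ S := by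
  intro e he f hf hef
  have hde : ¬ e.IsDiag := (mem_filter.1 (hG he)).2
  have hdf : ¬ f.IsDiag := (mem_filter.1 (hG hf)).2
  induction e using Sym2.ind with
  | _ i j =>
  induction f using Sym2.ind with
  | _ k l =>
  rw [Sym2.mk_isDiag_iff] at hde hdf
  by_cases hi : i = k ∨ i = l
  · refine ⟨_, mem_cutSpace.2 ⟨fun v => decide (v = j), rfl⟩, ?_⟩
    have h1 : j ≠ k ∧ j ≠ l := by
      rw [Ne, Sym2.eq_iff] at hef
      grind
    simp [mk_mem_cutOf, he, hde, h1.1.symm, h1.2.symm]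
  · push Not at hi
    refine ⟨_, mem_cutSpace.2 ⟨fun v => decide (v = i), rfl⟩, ?_⟩
    simp [mk_mem_cutOf, he, Ne.symm hde, hi.1.symm, hi.2.symm]

lemma exists_mem_cutSpace {G : Finset (Sym2 (Fin n))} (hG : G ⊆ edgeFinset n)
    {e : Sym2 (Fin n)} (he : e ∈ G) : ∃ S ∈ cutSpace G, e ∈ S := by
  have hde : ¬ e.IsDiag := (mem_filter.1 (hG he)).2
  induction e using Sym2.ind with
  | _ i j =>
  rw [Sym2.mk_isDiag_iff] at hde
  refine ⟨_, mem_cutSpace.2 ⟨fun v => decide (v = i), rfl⟩, ?_⟩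
  simp [mk_mem_cutOf, he, Ne.symm hde]

lemma isBridge_iff_singleton_mem_cutSpace {G : Finset (Sym2 (Fin n))} {i j : Fin n}
    (he : s(i, j) ∈ G) :
    (graphOf G).IsBridge s(i, j) ↔ {s(i, j)} ∈ cutSpace G := by
  rw [SimpleGraph.isBridge_iff]
  have hadj : ∀ {u v : Fin n}, ((graphOf G).deleteEdges {s(i, j)}).Adj u v ↔
      s(u, v) ∈ G ∧ u ≠ v ∧ s(u, v) ≠ s(i, j) := by
    intro u v
    simp only [graphOf, SimpleGraph.deleteEdges_adj, SimpleGraph.fromEdgeSet_adj, mem_coe,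
      Set.mem_singleton_iff]
    tauto
  generalize (graphOf G).deleteEdges {s(i, j)} = H at *
  constructor
  · intro h
    classical
    refine mem_cutSpace.2 ⟨fun v => decide (H.Reachable i v), ?_⟩
    ext e
    induction e using Sym2.ind with
    | _ u v =>
    rw [mk_mem_cutOf, mem_singleton]
    constructor
    · rintro ⟨huv, hne⟩
      by_contra hij
      have huv' : u ≠ v := by rintro rfl; exact hne rfl
      have hr : H.Reachable u v := (hadj.2 ⟨huv, huv', hij⟩).reachable
      refine hne (decide_eq_decide.2 ⟨fun h => h.trans hr, fun h => h.trans hr.symm⟩)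
    · intro huv
      refine ⟨huv ▸ he, ?_⟩
      rcases Sym2.eq_iff.1 huv with ⟨rfl, rfl⟩ | ⟨rfl, rfl⟩
      · simp [h]
      · simp [h]
  · intro h
    obtain ⟨c, hc⟩ := mem_cutSpace.1 h
    have hcij : c i ≠ c j := (mk_mem_cutOf.1 (hc ▸ mem_singleton_self s(i, j))).2
    have hstep : ∀ u v, H.Adj u v → c u = c v := by
      intro u v huv
      obtain ⟨h1, -, h3⟩ := hadj.1 huv
      by_contra hne
      exact h3 (mem_singleton.1 (hc ▸ mk_mem_cutOf.2 ⟨h1, hne⟩))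
    rintro ⟨p⟩
    refine hcij ?_
    clear hcij hadj hc h he
    induction p with
    | nil => rfl
    | cons huv _ ih => exact (hstep _ _ huv).trans ih

lemma isForest_iff {G : Finset (Sym2 (Fin n))} (hG : G ⊆ edgeFinset n) :
    IsForest G ↔ ∀ e ∈ G, {e} ∈ cutSpace G := by
  rw [IsForest, SimpleGraph.isAcyclic_iff_forall_isBridge]
  have hE : ∀ e, e ∈ (graphOf G).edgeSet ↔ e ∈ G := by
    intro e
    rw [graphOf, SimpleGraph.edgeSet_fromEdgeSet]
    exact ⟨fun h => h.1, fun h => ⟨h, (mem_filter.1 (hG h)).2⟩⟩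
  refine forall_congr' fun e => ?_
  rw [hE]
  refine imp_congr_right fun he => ?_
  induction e using Sym2.ind with
  | _ i j => exact isBridge_iff_singleton_mem_cutSpace he

end Cut

open Finset in
lemma fval_eq_div (n : ℕ) (G : Finset (Sym2 (Fin n))) :
    fval n G = (28 - 20 * #(singletonSupport (cutSpace G))
      - 4 * ((#(singletonSupport (cutSpace G))).choose 2 +
          #((reducedCode (cutSpace G)).filter fun S => #S = 2))
      + 3 * ((#(singletonSupport (cutSpace G))).choose 3 +
          #(singletonSupport (cutSpace G)) *
            #((reducedCode (cutSpace G)).filter fun S => #S = 2) +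
          #((reducedCode (cutSpace G)).filter fun S => #S = 3))) /
      (28 * (2 ^ #(singletonSupport (cutSpace G)) * #(reducedCode (cutSpace G)))) := by
  have h0 := empty_mem_cutSpace G
  have hC := symmDiff_mem_cutSpace G
  have z0 := card_filter_card_eq_zero (empty_mem_reducedCode h0)
  have z1 : #((reducedCode (cutSpace G)).filter fun S => #S = 1) = 0 := by
    rw [card_eq_zero, filter_eq_empty_iff]
    exact fun S hS => reducedCode_card_ne_one hS
  have hp : (#(reducedCode (cutSpace G)) : ℝ) ≠ 0 := by
    exact_mod_cast card_ne_zero_of_mem (empty_mem_reducedCode h0)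
  simp only [fval, qk_eq_div_card_cutSpace, card_filter_card_eq_sum h0 hC,
    card_eq_two_pow_mul h0 hC, Nat.sum_antidiagonal_eq_sum_range_succ_mk, sum_range_succ,
    sum_range_zero, z0, z1]
  simp
  field_simp
  ring

open Finset in
theorem fval_forest {n : ℕ} {G : Finset (Sym2 (Fin n))} (hG : G ⊆ edgeFinset n)
    (hF : IsForest G) :
    fval n G = (28 - 20 * #G - 4 * (#G).choose 2 + 3 * (#G).choose 3) / (28 * 2 ^ #G) := by
  have hB : singletonSupport (cutSpace G) = G := by
    ext e
    rw [mem_singletonSupport]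
    exact ⟨fun h => subset_of_mem_cutSpace h (mem_singleton_self e), (isForest_iff hG).1 hF e⟩
  have hR : reducedCode (cutSpace G) = {∅} := by
    ext S
    rw [mem_reducedCode, hB, mem_singleton]
    constructor
    · rintro ⟨hS, hd⟩
      exact disjoint_self.1 (hd.mono_right (subset_of_mem_cutSpace hS))
    · rintro rfl
      exact ⟨empty_mem_cutSpace G, disjoint_empty_left _⟩
  rw [fval_eq_div, hB, hR]
  simp [filter_singleton]

open Finset in
theorem fval_nonforest {n : ℕ} {G : Finset (Sym2 (Fin n))} (hG : G ⊆ edgeFinset n)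
    (hF : ¬ IsForest G) : -(3 / 28) ≤ fval n G := by
  rw [isForest_iff hG] at hF
  push Not at hF
  obtain ⟨e, he, heC⟩ := hF
  have h0 := empty_mem_cutSpace G
  have hC := symmDiff_mem_cutSpace G
  obtain ⟨S, hS, heS⟩ := exists_mem_cutSpace hG he
  have hp := four_le_card_reducedCode h0 hC (fun S hS => subset_of_mem_cutSpace hS)
    (exists_mem_cutSpace_of_ne hG) hS heS (mem_singletonSupport.not.2 heC)
  have hm := four_mul_card_filter_card_eq_two_le (symmDiff_mem_reducedCode hC)
  have key := nonforest_weight_ge (b := #(singletonSupport (cutSpace G)))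
    (t := #((reducedCode (cutSpace G)).filter fun S => #S = 3)) hp (card_filter_le _ _) hm
  have hp' : (0 : ℝ) < #(reducedCode (cutSpace G)) := by exact_mod_cast (by omega)
  rw [fval_eq_div, le_div_iff₀ (by positivity)]
  linarith

theorem fval_even_bound
    (n : ℕ) (G : Finset (Sym2 (Fin n))) (hG : G ⊆ edgeFinset n)
    (heven : Even G.card) :
    fval n G ≥ -(1 / 7) ∧
    (fval n G = -(1 / 7) ↔ (IsForest G ∧ (G.card = 2 ∨ G.card = 4))) ∧
    (¬(IsForest G ∧ (G.card = 2 ∨ G.card = 4)) →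
      fval n G ≥ -(1 / 7) + 1 / 28) := by
  have heq : IsForest G ∧ (G.card = 2 ∨ G.card = 4) → fval n G = -(1 / 7) := by
    rintro ⟨hF, h | h⟩ <;> rw [fval_forest hG hF, h] <;> norm_num [Nat.choose]
  have hne : ¬(IsForest G ∧ (G.card = 2 ∨ G.card = 4)) → fval n G ≥ -(1 / 7) + 1 / 28 := by
    intro h
    by_cases hF : IsForest G
    · have h' : ¬(G.card = 2 ∨ G.card = 4) := fun hc => h ⟨hF, hc⟩
      push Not at h'
      have := forest_weight_ge_of_even heven h'.1 h'.2
      rw [fval_forest hG hF, ge_iff_le, le_div_iff₀ (by positivity)]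
      linarith
    · have := fval_nonforest hG hF
      linarith
  refine ⟨?_, ⟨fun h => ?_, heq⟩, hne⟩
  · by_cases h : IsForest G ∧ (G.card = 2 ∨ G.card = 4)
    · exact (heq h).ge
    · linarith [hne h]
  · by_contra hc
    linarith [hne hc]
end
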